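/- arXiv:1405.3052 — 3 statements merged into one kernel-verified Lean document; each statement's English description precedes it below -/
import Mathlib

section
/- Let θ > 0 and a > 0, and set Mu = D₀²u − θ(D₁²u + x₁²ξₙ²u). There exists C > 0 such that for every real s ≥ 1 there is τ₀ > 0 such that for all τ ≥ τ₀, all ξₙ ∈ ℝ, and all smooth compactly supported u : ℝ² → ℂ, one has ∫₀^∞ W(x₀)‖Mu(x₀)‖² dx₀ ≥ C W(0)(τ⟨ξₙ⟩^{1/s} E₁(u(0)) + τ³⟨ξₙ⟩^{3/s} E₀(u(0))) + C τ² ∫₀^∞ W(x₀)⟨ξₙ⟩^{2/s} E₁(u(x₀)) dx₀ + C τ⁴ ∫₀^∞ W(x₀)⟨ξₙ⟩^{4/s} E₀(u(x₀)) dx₀. -/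
open Complex MeasureTheory

/-- `D₀ = -i ∂/∂x₀` on functions of `(x₀, x₁) ∈ ℝ²`. -/
noncomputable def D0 (u : ℝ × ℝ → ℂ) : ℝ × ℝ → ℂ :=
  fun p => -Complex.I * fderiv ℝ u p (1, 0)

/-- `D₁ = -i ∂/∂x₁` on functions of `(x₀, x₁) ∈ ℝ²`. -/
noncomputable def D1 (u : ℝ × ℝ → ℂ) : ℝ × ℝ → ℂ :=
  fun p => -Complex.I * fderiv ℝ u p (0, 1)

/-- `‖v(x₀)‖² = ∫ |v(x₀, x₁)|² dx₁`. -/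
noncomputable def nsq (v : ℝ × ℝ → ℂ) (x₀ : ℝ) : ℝ :=
  ∫ x₁ : ℝ, ‖v (x₀, x₁)‖ ^ 2

/-- `E_j(u(x₀)) = ‖D₀^j u(x₀)‖² + ‖D₁^j u(x₀)‖² + ‖(x₁ξₙ)^j u(x₀)‖²`. -/
noncomputable def Ej (ξₙ : ℝ) (j : ℕ) (u : ℝ × ℝ → ℂ) (x₀ : ℝ) : ℝ :=
  nsq (D0^[j] u) x₀ + nsq (D1^[j] u) x₀ + nsq (fun p => (↑((p.2 * ξₙ) ^ j) : ℂ) * u p) x₀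

/-- The Gevrey weight `W(x₀) = exp(2τ⟨ξₙ⟩^{1/s}(x₀ − a))`, where `⟨ξₙ⟩ = √(1+ξₙ²)`. -/
noncomputable def Wt (τ ξₙ s a : ℝ) (x₀ : ℝ) : ℝ :=
  Real.exp (2 * τ * (Real.sqrt (1 + ξₙ ^ 2)) ^ (1 / s) * (x₀ - a))

/-- The multiplier `M u = D₀²u − θ(D₁²u + x₁²ξₙ²u)`. -/
noncomputable def Mop (θ ξₙ : ℝ) (u : ℝ × ℝ → ℂ) : ℝ × ℝ → ℂ :=
  fun p => D0 (D0 u) p - (θ : ℂ) * (D1 (D1 u) p + (↑(p.2 ^ 2 * ξₙ ^ 2) : ℂ) * u p)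

section Integration

variable {f f' : ℝ × ℝ → ℝ}

lemma integrable_slice_fst (hc : Continuous f) (hs : HasCompactSupport f) (t : ℝ) :
    Integrable fun x => f (t, x) := by
  refine (hc.comp (Continuous.prodMk_right t)).integrable_of_hasCompactSupport ?_
  refine HasCompactSupport.intro (hs.isCompact.image continuous_snd) fun x hx => ?_
  exact image_eq_zero_of_notMem_tsupport (f := f) (x := (t, x)) fun h => hx ⟨(t, x), h, rfl⟩

lemma hasCompactSupport_slice_snd (hs : HasCompactSupport f) (x : ℝ) :
    HasCompactSupport fun t => f (t, x) := by
  refine HasCompactSupport.intro (hs.isCompact.image continuous_fst) fun t ht => ?_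
  exact image_eq_zero_of_notMem_tsupport fun h => ht ⟨(t, x), h, rfl⟩

lemma integrable_halfPlane (hc : Continuous f) (hs : HasCompactSupport f) :
    Integrable f ((volume.restrict (Set.Ioi (0 : ℝ))).prod (volume : Measure ℝ)) := by
  have h : Integrable f ((volume : Measure ℝ).prod (volume : Measure ℝ)) :=
    hc.integrable_of_hasCompactSupport hs
  have hle : (volume.restrict (Set.Ioi (0 : ℝ))).prod (volume : Measure ℝ)
      ≤ (volume : Measure ℝ).prod (volume : Measure ℝ) :=
    Measure.prod_mono Measure.restrict_le_self le_rfl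
  exact h.mono_measure hle

lemma integral_halfPlane_deriv_fst (hs : HasCompactSupport f)
    (hc' : Continuous f') (hs' : HasCompactSupport f')
    (hd : ∀ t x, HasDerivAt (fun t => f (t, x)) (f' (t, x)) t) :
    ∫ p, f' p ∂((volume.restrict (Set.Ioi (0 : ℝ))).prod (volume : Measure ℝ))
      = -∫ x, f (0, x) := by
  rw [integral_prod_symm _ (integrable_halfPlane hc' hs'), ← integral_neg]
  congr 1 with x
  have hderiv : deriv (fun t => f (t, x)) = fun t => f' (t, x) :=
    funext fun t => (hd t x).deriv
  have hC1 : ContDiff ℝ 1 fun t => f (t, x) := by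
    refine contDiff_one_iff_deriv.2 ⟨fun t => (hd t x).differentiableAt, ?_⟩
    rw [hderiv]
    fun_prop
  simpa [hderiv] using (hasCompactSupport_slice_snd hs x).integral_Ioi_deriv_eq hC1 0

lemma integral_halfPlane_deriv_snd (hc : Continuous f) (hs : HasCompactSupport f)
    (hc' : Continuous f') (hs' : HasCompactSupport f')
    (hd : ∀ t x, HasDerivAt (fun x => f (t, x)) (f' (t, x)) x) :
    ∫ p, f' p ∂((volume.restrict (Set.Ioi (0 : ℝ))).prod (volume : Measure ℝ)) = 0 := by
  rw [integral_prod _ (integrable_halfPlane hc' hs')]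
  have h (t : ℝ) : ∫ x, f' (t, x) = 0 :=
    integral_eq_zero_of_hasDerivAt_of_integrable (hd t) (integrable_slice_fst hc' hs' t)
      (integrable_slice_fst hc hs t)
  simp [h]

end Integration

section Partial

variable {u : ℝ × ℝ → ℂ}

lemma hasDerivAt_slice_fst (hu : Differentiable ℝ u) (t x : ℝ) :
    HasDerivAt (fun t => u (t, x)) (fderiv ℝ u (t, x) (1, 0)) t :=
  (hu (t, x)).hasFDerivAt.comp_hasDerivAt t ((hasDerivAt_id t).prodMk (hasDerivAt_const t x))

lemma hasDerivAt_slice_snd (hu : Differentiable ℝ u) (t x : ℝ) :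
    HasDerivAt (fun x => u (t, x)) (fderiv ℝ u (t, x) (0, 1)) x :=
  (hu (t, x)).hasFDerivAt.comp_hasDerivAt x ((hasDerivAt_const x t).prodMk (hasDerivAt_id x))

lemma contDiff_fderiv_apply (hu : ContDiff ℝ (⊤ : ℕ∞) u) (v : ℝ × ℝ) :
    ContDiff ℝ (⊤ : ℕ∞) fun p => fderiv ℝ u p v :=
  (hu.fderiv_right (m := (⊤ : ℕ∞)) (by simp)).clm_apply contDiff_const

lemma fderiv_fderiv_apply_comm (hu : ContDiff ℝ (⊤ : ℕ∞) u) (v w p : ℝ × ℝ) :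
    fderiv ℝ (fun q => fderiv ℝ u q v) p w = fderiv ℝ (fun q => fderiv ℝ u q w) p v := by
  have hd : DifferentiableAt ℝ (fderiv ℝ u) p :=
    (hu.fderiv_right (m := (⊤ : ℕ∞)) (by simp)).differentiable (by simp) p
  have hsymm : IsSymmSndFDerivAt ℝ u p :=
    hu.contDiffAt.isSymmSndFDerivAt (by
      rw [minSmoothness_of_isRCLikeNormedField]; exact WithTop.coe_le_coe.2 le_top)
  rw [fderiv_clm_apply hd (by fun_prop), fderiv_clm_apply hd (by fun_prop)]
  simpa using hsymm.eq w v

lemma D0_D0_apply (hu : ContDiff ℝ (⊤ : ℕ∞) u) (p : ℝ × ℝ) :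
    D0 (D0 u) p = -fderiv ℝ (fun q => fderiv ℝ u q (1, 0)) p (1, 0) := by
  have h := (contDiff_fderiv_apply hu (1, 0)).differentiable (by simp) p
  change -Complex.I * fderiv ℝ (fun q => -Complex.I * fderiv ℝ u q (1, 0)) p (1, 0) = _
  rw [fderiv_const_mul h]
  simp [← mul_assoc]

lemma D1_D1_apply (hu : ContDiff ℝ (⊤ : ℕ∞) u) (p : ℝ × ℝ) :
    D1 (D1 u) p = -fderiv ℝ (fun q => fderiv ℝ u q (0, 1)) p (0, 1) := by
  have h := (contDiff_fderiv_apply hu (0, 1)).differentiable (by simp) p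
  change -Complex.I * fderiv ℝ (fun q => -Complex.I * fderiv ℝ u q (0, 1)) p (0, 1) = _
  rw [fderiv_const_mul h]
  simp [← mul_assoc]

end Partial

/-- Completing squares: the left-hand side is a lower bound for `‖M u‖²` plus divergence terms. -/
lemma energy_density_le (θ l y : ℝ) (u u0 u00 u1 u01 u11 : ℂ) :
    l ^ 2 / 2 * ‖u0‖ ^ 2 + 2 * l ^ 2 * θ * (‖u1‖ ^ 2 + y ^ 2 * ‖u‖ ^ 2) + l ^ 4 / 2 * ‖u‖ ^ 2
      ≤ ‖-u00 - (θ : ℂ) * (-u11 + ((y ^ 2 : ℝ) : ℂ) * u)‖ ^ 2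
        + (2 * l * (l * (‖u0‖ ^ 2 + θ * ‖u1‖ ^ 2 + θ * y ^ 2 * ‖u‖ ^ 2) + l ^ 3 / 2 * ‖u‖ ^ 2)
          + (l * (2 * inner ℝ u0 u00 + θ * (2 * inner ℝ u1 u01)
              + θ * y ^ 2 * (2 * inner ℝ u u0)) + l ^ 3 / 2 * (2 * inner ℝ u u0)))
        - 2 * θ * l * (inner ℝ u1 u01 + inner ℝ u11 u0) := by
  set m : ℂ := -u00 - (θ : ℂ) * (-u11 + ((y ^ 2 : ℝ) : ℂ) * u) with hm
  have hinner : inner ℝ u0 m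
      = -inner ℝ u0 u00 + θ * inner ℝ u11 u0 - θ * y ^ 2 * inner ℝ u u0 := by
    simp only [hm, Complex.inner, Complex.mul_re, Complex.mul_im, Complex.sub_re, Complex.sub_im,
      Complex.neg_re, Complex.neg_im, Complex.add_re, Complex.add_im, Complex.ofReal_re,
      Complex.ofReal_im, Complex.conj_re, Complex.conj_im]
    ring
  have h1 : 0 ≤ ‖m‖ ^ 2 - 2 * l * inner ℝ u0 m + l ^ 2 * ‖u0‖ ^ 2 := by
    have h := norm_sub_sq_real m (l • u0)
    rw [inner_smul_right, norm_smul, mul_pow, Real.norm_eq_abs, sq_abs, real_inner_comm] at h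
    linarith [sq_nonneg ‖m - l • u0‖]
  have h2 : 0 ≤ ‖u0‖ ^ 2 + 2 * l * inner ℝ u u0 + l ^ 2 * ‖u‖ ^ 2 := by
    have h := norm_add_sq_real u0 (l • u)
    rw [inner_smul_right, norm_smul, mul_pow, Real.norm_eq_abs, sq_abs, real_inner_comm] at h
    linarith [sq_nonneg ‖u0 + l • u‖]
  rw [hinner] at h1
  linarith [mul_nonneg (sq_nonneg l) h2]

/-- The energy estimate at a fixed frequency, with `l = τ⟨ξ⟩^{1/s}`. -/
lemma halfPlane_energy_estimate (θ l a ξ C : ℝ) (hθ : 0 < θ) (hl : 0 < l)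
    (hCθ : C ≤ θ) (hC : 6 * C ≤ 1) {u : ℝ × ℝ → ℂ}
    (hu : ContDiff ℝ (⊤ : ℕ∞) u) (hs : HasCompactSupport u) :
    C * Real.exp (2 * l * (0 - a)) * (l * Ej ξ 1 u 0 + l ^ 3 * Ej ξ 0 u 0)
        + C * l ^ 2 * (∫ t in Set.Ioi (0 : ℝ), Real.exp (2 * l * (t - a)) * Ej ξ 1 u t)
        + C * l ^ 4 * (∫ t in Set.Ioi (0 : ℝ), Real.exp (2 * l * (t - a)) * Ej ξ 0 u t)
      ≤ ∫ t in Set.Ioi (0 : ℝ), Real.exp (2 * l * (t - a)) * nsq (Mop θ ξ u) t := by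
  have hC2 : 2 * C ≤ 1 := by linarith
  have hC1 : C ≤ 1 := by linarith
  set μ := (volume.restrict (Set.Ioi (0 : ℝ))).prod (volume : Measure ℝ)
  set w : ℝ → ℝ := fun t => Real.exp (2 * l * (t - a)) with hw
  have hwc : Continuous w := by fun_prop
  have hwd (t : ℝ) : HasDerivAt w (2 * l * w t) t := by
    have h := (((hasDerivAt_id t).sub_const a).const_mul (2 * l)).exp
    refine h.congr_deriv ?_
    simp [hw, mul_comm]
  set u0 : ℝ × ℝ → ℂ := fun p => fderiv ℝ u p (1, 0) with hu0
  set u1 : ℝ × ℝ → ℂ := fun p => fderiv ℝ u p (0, 1) with hu1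
  have hu0s : ContDiff ℝ (⊤ : ℕ∞) u0 := contDiff_fderiv_apply hu _
  have hu1s : ContDiff ℝ (⊤ : ℕ∞) u1 := contDiff_fderiv_apply hu _
  set u00 : ℝ × ℝ → ℂ := fun p => fderiv ℝ u0 p (1, 0) with hu00
  set u01 : ℝ × ℝ → ℂ := fun p => fderiv ℝ u1 p (1, 0) with hu01
  set u11 : ℝ × ℝ → ℂ := fun p => fderiv ℝ u1 p (0, 1) with hu11
  have cu : Continuous u := hu.continuous
  have cu0 : Continuous u0 := hu0s.continuous
  have cu1 : Continuous u1 := hu1s.continuous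
  have cu00 : Continuous u00 := (contDiff_fderiv_apply hu0s _).continuous
  have cu01 : Continuous u01 := (contDiff_fderiv_apply hu1s _).continuous
  have cu11 : Continuous u11 := (contDiff_fderiv_apply hu1s _).continuous
  have du : Differentiable ℝ u := hu.differentiable (by simp)
  have du0 : Differentiable ℝ u0 := hu0s.differentiable (by simp)
  have du1 : Differentiable ℝ u1 := hu1s.differentiable (by simp)
  have hu10 (p : ℝ × ℝ) : fderiv ℝ u0 p (0, 1) = u01 p := fderiv_fderiv_apply_comm hu _ _ p
  have s0 : tsupport u0 ⊆ tsupport u := tsupport_fderiv_apply_subset ℝ _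
  have s1 : tsupport u1 ⊆ tsupport u := tsupport_fderiv_apply_subset ℝ _
  have s00 : tsupport u00 ⊆ tsupport u := (tsupport_fderiv_apply_subset ℝ _).trans s0
  have s01 : tsupport u01 ⊆ tsupport u := (tsupport_fderiv_apply_subset ℝ _).trans s1
  have s11 : tsupport u11 ⊆ tsupport u := (tsupport_fderiv_apply_subset ℝ _).trans s1
  have hsupp {F : ℝ × ℝ → ℝ} (hF : ∀ p, u p = 0 → u0 p = 0 → u1 p = 0 → u00 p = 0 → u01 p = 0 →
      u11 p = 0 → F p = 0) : HasCompactSupport F := by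
    refine HasCompactSupport.intro hs.isCompact fun p hp => hF p ?_ ?_ ?_ ?_ ?_ ?_
    · exact image_eq_zero_of_notMem_tsupport hp
    · exact image_eq_zero_of_notMem_tsupport fun h => hp (s0 h)
    · exact image_eq_zero_of_notMem_tsupport fun h => hp (s1 h)
    · exact image_eq_zero_of_notMem_tsupport fun h => hp (s00 h)
    · exact image_eq_zero_of_notMem_tsupport fun h => hp (s01 h)
    · exact image_eq_zero_of_notMem_tsupport fun h => hp (s11 h)
  -- the densities of `E₀`, `E₁` and `‖M u‖²`
  set e0 : ℝ × ℝ → ℝ := fun p => 3 * ‖u p‖ ^ 2 with he0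
  set e1 : ℝ × ℝ → ℝ := fun p => ‖u0 p‖ ^ 2 + ‖u1 p‖ ^ 2 + (p.2 * ξ) ^ 2 * ‖u p‖ ^ 2 with he1
  set m : ℝ × ℝ → ℝ := fun p =>
    ‖-u00 p - (θ : ℂ) * (-u11 p + (((p.2 * ξ) ^ 2 : ℝ) : ℂ) * u p)‖ ^ 2 with hm
  have hE0 (t : ℝ) : Ej ξ 0 u t = ∫ x, e0 (t, x) := by
    simp only [Ej, nsq, he0, Function.iterate_zero, id, pow_zero, Complex.ofReal_one, one_mul,
      integral_const_mul]
    ring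
  have hE1 (t : ℝ) : Ej ξ 1 u t = ∫ x, e1 (t, x) := by
    have i0 : Integrable fun x => ‖u0 (t, x)‖ ^ 2 :=
      integrable_slice_fst (f := fun p => ‖u0 p‖ ^ 2) (by fun_prop)
        (hsupp fun p => by simp +contextual) t
    have i1 : Integrable fun x => ‖u1 (t, x)‖ ^ 2 :=
      integrable_slice_fst (f := fun p => ‖u1 p‖ ^ 2) (by fun_prop)
        (hsupp fun p => by simp +contextual) t
    have i2 : Integrable fun x => (x * ξ) ^ 2 * ‖u (t, x)‖ ^ 2 :=
      integrable_slice_fst (f := fun p => (p.2 * ξ) ^ 2 * ‖u p‖ ^ 2) (by fun_prop)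
        (hsupp fun p => by simp +contextual) t
    have i01 : Integrable fun x => ‖u0 (t, x)‖ ^ 2 + ‖u1 (t, x)‖ ^ 2 := i0.add i1
    simp only [he1]
    rw [integral_add i01 i2, integral_add i0 i1]
    simp [Ej, nsq, D0, D1, hu0, hu1, mul_pow]
  have hM (t : ℝ) : nsq (Mop θ ξ u) t = ∫ x, m (t, x) := by
    simp only [nsq, Mop, D0_D0_apply hu, D1_D1_apply hu, hm, mul_pow, hu00, hu11, hu0, hu1]
  have ce0 : Continuous e0 := by fun_prop
  have ce1 : Continuous e1 := by fun_prop
  have cm : Continuous m := by fun_prop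
  have se0 : HasCompactSupport e0 := hsupp fun p => by simp +contextual [he0]
  have se1 : HasCompactSupport e1 := hsupp fun p => by simp +contextual [he1]
  have sm : HasCompactSupport m := hsupp fun p => by simp +contextual [hm]
  have hint {F : ℝ × ℝ → ℝ} (hF : Continuous F) (hFs : HasCompactSupport F) :
      Integrable (fun p => w p.1 * F p) μ ∧
        ∫ t in Set.Ioi (0 : ℝ), w t * ∫ x, F (t, x) = ∫ p, w p.1 * F p ∂μ := by
    have hi : Integrable (fun p => w p.1 * F p) μ :=
      integrable_halfPlane (by fun_prop) hFs.mul_left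
    exact ⟨hi, by rw [integral_prod _ hi]; simp only [integral_const_mul]⟩
  obtain ⟨ie0, ee0⟩ := hint ce0 se0
  obtain ⟨ie1, ee1⟩ := hint ce1 se1
  obtain ⟨im, em⟩ := hint cm sm
  -- the fluxes in the `x₀` and `x₁` directions, with their derivatives
  set b : ℝ × ℝ → ℝ := fun p =>
    l * (‖u0 p‖ ^ 2 + θ * ‖u1 p‖ ^ 2 + θ * (p.2 * ξ) ^ 2 * ‖u p‖ ^ 2) + l ^ 3 / 2 * ‖u p‖ ^ 2
    with hb
  set b' : ℝ × ℝ → ℝ := fun p =>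
    l * (2 * inner ℝ (u0 p) (u00 p) + θ * (2 * inner ℝ (u1 p) (u01 p))
      + θ * (p.2 * ξ) ^ 2 * (2 * inner ℝ (u p) (u0 p))) + l ^ 3 / 2 * (2 * inner ℝ (u p) (u0 p))
    with hb'
  set q : ℝ × ℝ → ℝ := fun p => inner ℝ (u1 p) (u0 p) with hq
  set q' : ℝ × ℝ → ℝ := fun p => inner ℝ (u1 p) (u01 p) + inner ℝ (u11 p) (u0 p) with hq'
  have cb : Continuous b := by fun_prop
  have cb' : Continuous b' := by fun_prop
  have cq : Continuous q := by fun_prop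
  have cq' : Continuous q' := by fun_prop
  have sb : HasCompactSupport b := hsupp fun p => by simp +contextual [hb]
  have sb' : HasCompactSupport b' := hsupp fun p => by simp +contextual [hb']
  have sq : HasCompactSupport q := hsupp fun p => by simp +contextual [hq]
  have sq' : HasCompactSupport q' := hsupp fun p => by simp +contextual [hq']
  have hbd (t x : ℝ) : HasDerivAt (fun t => b (t, x)) (b' (t, x)) t := by
    have d (v : ℝ × ℝ → ℂ) (hv : Differentiable ℝ v) :=
      (hasDerivAt_slice_fst hv t x).norm_sq
    exact ((((d u0 du0).add ((d u1 du1).const_mul θ)).add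
      ((d u du).const_mul (θ * (x * ξ) ^ 2))).const_mul l).add ((d u du).const_mul (l ^ 3 / 2))
  have hqd (t x : ℝ) : HasDerivAt (fun x => q (t, x)) (q' (t, x)) x := by
    have h := (hasDerivAt_slice_snd du1 t x).inner ℝ (hasDerivAt_slice_snd du0 t x)
    rwa [hu10] at h
  have sB : HasCompactSupport fun p => 2 * l * b p + b' p := sb.mul_left.add sb'
  have hB : ∫ p, w p.1 * (2 * l * b p + b' p) ∂μ = -∫ x, w 0 * b (0, x) :=
    integral_halfPlane_deriv_fst (f := fun p => w p.1 * b p) sb.mul_left (by fun_prop)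
      sB.mul_left fun t x => ((hwd t).mul (hbd t x)).congr_deriv (by ring)
  have hQ : ∫ p, w p.1 * q' p ∂μ = 0 :=
    integral_halfPlane_deriv_snd (f := fun p => w p.1 * q p) (by fun_prop) sq.mul_left
      (by fun_prop) sq'.mul_left fun t x => (hqd t x).const_mul (w t)
  have iB : Integrable (fun p => w p.1 * (2 * l * b p + b' p)) μ := (hint (by fun_prop) sB).1
  have iQ : Integrable (fun p => w p.1 * q' p) μ := (hint cq' sq').1
  have imB : Integrable (fun p => w p.1 * m p + w p.1 * (2 * l * b p + b' p)) μ := im.add iB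
  have hinterior : C * l ^ 2 * (∫ p, w p.1 * e1 p ∂μ) + C * l ^ 4 * (∫ p, w p.1 * e0 p ∂μ)
      ≤ (∫ p, w p.1 * m p ∂μ) + (∫ p, w p.1 * (2 * l * b p + b' p) ∂μ)
        - 2 * θ * l * ∫ p, w p.1 * q' p ∂μ := by
    rw [← integral_const_mul, ← integral_const_mul, ← integral_const_mul,
      ← integral_add (ie1.const_mul _) (ie0.const_mul _), ← integral_add im iB,
      ← integral_sub imB (iQ.const_mul _)]
    refine integral_mono ((ie1.const_mul _).add (ie0.const_mul _))
      (imB.sub (iQ.const_mul _)) fun p => ?_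
    have hle : C * l ^ 2 * e1 p + C * l ^ 4 * e0 p
        ≤ m p + (2 * l * b p + b' p) - 2 * θ * l * q' p := by
      refine le_trans ?_
        (energy_density_le θ l (p.2 * ξ) (u p) (u0 p) (u00 p) (u1 p) (u01 p) (u11 p))
      have k0 : 0 ≤ l ^ 2 * ‖u0 p‖ ^ 2 := by positivity
      have k1 : 0 ≤ l ^ 2 * (‖u1 p‖ ^ 2 + (p.2 * ξ) ^ 2 * ‖u p‖ ^ 2) := by positivity
      have k2 : 0 ≤ l ^ 4 * ‖u p‖ ^ 2 := by positivity
      simp only [he0, he1]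
      linarith [mul_nonneg (sub_nonneg.2 hC2) k0, mul_nonneg (sub_nonneg.2 hCθ) k1,
        mul_nonneg (sub_nonneg.2 hC) k2, mul_nonneg hθ.le k1]
    have h := mul_le_mul_of_nonneg_left hle (Real.exp_pos (2 * l * (p.1 - a))).le
    simp only [hw]
    linarith
  have hboundary : C * w 0 * (l * (∫ x, e1 (0, x)) + l ^ 3 * ∫ x, e0 (0, x))
      ≤ ∫ x, w 0 * b (0, x) := by
    have j0 := integrable_slice_fst ce0 se0 0
    have j1 := integrable_slice_fst ce1 se1 0
    rw [← integral_const_mul, ← integral_const_mul,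
      ← integral_add (j1.const_mul _) (j0.const_mul _), ← integral_const_mul]
    refine integral_mono (((j1.const_mul _).add (j0.const_mul _)).const_mul _)
      ((integrable_slice_fst cb sb 0).const_mul _) fun x => ?_
    have hle : C * (l * e1 (0, x) + l ^ 3 * e0 (0, x)) ≤ b (0, x) := by
      have k0 : 0 ≤ l * ‖u0 (0, x)‖ ^ 2 := by positivity
      have k1 : 0 ≤ l * (‖u1 (0, x)‖ ^ 2 + (x * ξ) ^ 2 * ‖u (0, x)‖ ^ 2) := by positivity
      have k2 : 0 ≤ l ^ 3 * ‖u (0, x)‖ ^ 2 := by positivity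
      simp only [he0, he1, hb]
      linarith [mul_nonneg (sub_nonneg.2 hC1) k0, mul_nonneg (sub_nonneg.2 hCθ) k1,
        mul_nonneg (sub_nonneg.2 hC) k2]
    have h := mul_le_mul_of_nonneg_left hle (Real.exp_pos (2 * l * (0 - a))).le
    simp only [hw]
    linarith
  simp only [hE0, hE1, hM]
  rw [ee0, ee1, em]
  change C * w 0 * _ + _ + _ ≤ _
  rw [hB, hQ] at hinterior
  linarith

/-- The weighted energy estimate of Lemma 2.1 for the multiplier `M = D₀² − θΩ`. -/
theorem multiplier_energy_estimate (θ a : ℝ) (hθ : 0 < θ) (ha : 0 < a) :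
    ∃ C > (0:ℝ), ∀ s : ℝ, 1 ≤ s → ∃ τ₀ > (0:ℝ), ∀ τ : ℝ, τ₀ ≤ τ → ∀ ξₙ : ℝ,
      ∀ u : ℝ × ℝ → ℂ, ContDiff ℝ (⊤ : ℕ∞) u → HasCompactSupport u →
        (∫ x₀ in Set.Ioi (0:ℝ), Wt τ ξₙ s a x₀ * nsq (Mop θ ξₙ u) x₀)
          ≥ C * Wt τ ξₙ s a 0 *
              (τ * (Real.sqrt (1 + ξₙ ^ 2)) ^ (1 / s) * Ej ξₙ 1 u 0
               + τ ^ 3 * (Real.sqrt (1 + ξₙ ^ 2)) ^ (3 / s) * Ej ξₙ 0 u 0)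
            + C * τ ^ 2 *
                (∫ x₀ in Set.Ioi (0:ℝ),
                  Wt τ ξₙ s a x₀ * (Real.sqrt (1 + ξₙ ^ 2)) ^ (2 / s) * Ej ξₙ 1 u x₀)
            + C * τ ^ 4 *
                (∫ x₀ in Set.Ioi (0:ℝ),
                  Wt τ ξₙ s a x₀ * (Real.sqrt (1 + ξₙ ^ 2)) ^ (4 / s) * Ej ξₙ 0 u x₀) := by
  refine ⟨min (1 / 6) θ, by positivity, fun s _ => ⟨1, one_pos, ?_⟩⟩
  intro τ hτ ξₙ u hu hs
  have hC6 : min (1 / 6) θ ≤ 1 / 6 := min_le_left _ _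
  have hCθ : min (1 / 6) θ ≤ θ := min_le_right _ _
  set C := min (1 / 6) θ
  have hJ : 0 < Real.sqrt (1 + ξₙ ^ 2) := by positivity
  set J := Real.sqrt (1 + ξₙ ^ 2)
  have hpow (n : ℕ) : J ^ ((n : ℝ) / s) = (J ^ (1 / s)) ^ n := by
    rw [← Real.rpow_mul_natCast hJ.le]
    congr 1
    ring
  have h2 : J ^ (2 / s) = (J ^ (1 / s)) ^ 2 := by exact_mod_cast hpow 2
  have h3 : J ^ (3 / s) = (J ^ (1 / s)) ^ 3 := by exact_mod_cast hpow 3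
  have h4 : J ^ (4 / s) = (J ^ (1 / s)) ^ 4 := by exact_mod_cast hpow 4
  have hr : 0 < J ^ (1 / s) := by positivity
  have hW (t : ℝ) : Wt τ ξₙ s a t = Real.exp (2 * (τ * J ^ (1 / s)) * (t - a)) := by
    simp only [Wt, J, mul_assoc]
  have key := halfPlane_energy_estimate θ (τ * J ^ (1 / s)) a ξₙ C hθ
    (mul_pos (by linarith) hr) hCθ (by linarith) hu hs
  simp only [hW, h2, h3, h4]
  set r := J ^ (1 / s)
  refine ge_iff_le.2 (le_of_eq_of_le ?_ key)
  have hpull (k : ℝ) (F : ℝ → ℝ) :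
      ∫ t in Set.Ioi (0 : ℝ), Real.exp (2 * (τ * r) * (t - a)) * k * F t
        = k * ∫ t in Set.Ioi (0 : ℝ), Real.exp (2 * (τ * r) * (t - a)) * F t := by
    rw [← integral_const_mul]
    congr 1 with t
    ring
  rw [hpull, hpull]
  ring
end

section
/- Let b₀ ∈ ℝ with |b₀| < 2/(3√3), let a > 0, and define the fiberwise operator P_{ξₙ}u = D₀³u − (D₁² + x₁²ξₙ²)D₀u − b₀x₁³ξₙ³u. There exists C > 0 such that for every real s with 1 ≤ s ≤ 2 there is τ₀ > 0 such that for all τ ≥ τ₀, all ξₙ ∈ ℝ, and all smooth compactly supported u : ℝ² → ℂ: ∫₀^∞ W(x₀)‖P_{ξₙ}u(x₀)‖² dx₀ ≥ C W(0) Σ_{j=0}^{2} τ^{4−3j/2} ⟨ξₙ⟩^{(5−2j)/s} E_j(u(0)) + C Σ_{j=0}^{2} τ^{6−2j} ∫₀^∞ W(x₀) ⟨ξₙ⟩^{(6−2j)/s} E_j(u(x₀)) dx₀. -/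
open Complex MeasureTheory

/-- The fiberwise operator `P_{ξₙ} u = D₀³u − (D₁² + x₁²ξₙ²)D₀u − b₀x₁³ξₙ³u`. -/
noncomputable def Pfib (b₀ ξₙ : ℝ) (u : ℝ × ℝ → ℂ) : ℝ × ℝ → ℂ :=
  fun p =>
    D0 (D0 (D0 u)) p - (D1 (D1 (D0 u)) p + (↑(p.2 ^ 2 * ξₙ ^ 2) : ℂ) * D0 u p)
      - (↑(b₀ * p.2 ^ 3 * ξₙ ^ 3) : ℂ) * u p

section Integration

theorem integral_linearCombination_nonneg {α : Type*} [MeasurableSpace α] {ν : Measure α} {n : ℕ}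
    (c : Fin n → ℝ) (φ : Fin n → α → ℝ) (hφ : ∀ i, Integrable (φ i) ν)
    (h : ∀ p, 0 ≤ ∑ i, c i * φ i p) : 0 ≤ ∑ i, c i * ∫ p, φ i p ∂ν := by
  simp_rw [← integral_const_mul]
  rw [← integral_finsetSum _ fun i _ => (hφ i).const_mul (c i)]
  exact integral_nonneg h

theorem integrable_of_continuous_of_zero_off {ν : Measure (ℝ × ℝ)} [IsFiniteMeasureOnCompacts ν]
    {E : Type*} [NormedAddCommGroup E] {K : Set (ℝ × ℝ)} (hK : IsCompact K) {φ : ℝ × ℝ → E}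
    (hc : Continuous φ) (h0 : ∀ p ∉ K, φ p = 0) : Integrable φ ν :=
  hc.integrable_of_hasCompactSupport (HasCompactSupport.intro hK h0)

theorem hasCompactSupport_slice_right {E : Type*} [Zero E] {K : Set (ℝ × ℝ)}
    (hK : IsCompact K) {φ : ℝ × ℝ → E} (h0 : ∀ p ∉ K, φ p = 0) (t : ℝ) :
    HasCompactSupport fun x => φ (t, x) :=
  HasCompactSupport.intro (hK.image continuous_snd) fun _ hx =>
    h0 _ fun h => hx ⟨_, h, rfl⟩

theorem hasCompactSupport_slice_left {E : Type*} [Zero E] {K : Set (ℝ × ℝ)}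
    (hK : IsCompact K) {φ : ℝ × ℝ → E} (h0 : ∀ p ∉ K, φ p = 0) (x : ℝ) :
    HasCompactSupport fun t => φ (t, x) :=
  HasCompactSupport.intro (hK.image continuous_fst) fun _ ht =>
    h0 _ fun h => ht ⟨_, h, rfl⟩

/-- Integrals of `x₁`-derivatives against `ρ ⊗ dx₁` vanish. -/
theorem integral_prod_deriv_snd_eq_zero {ρ : Measure ℝ} [SFinite ρ] [IsLocallyFiniteMeasure ρ]
    {K : Set (ℝ × ℝ)} (hK : IsCompact K) {φ ψ : ℝ × ℝ → ℝ} (hφ : Continuous φ) (hψ : Continuous ψ)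
    (hφ0 : ∀ p ∉ K, φ p = 0) (hψ0 : ∀ p ∉ K, ψ p = 0)
    (hd : ∀ t x, HasDerivAt (fun x => φ (t, x)) (ψ (t, x)) x) :
    ∫ p, ψ p ∂(ρ.prod volume) = 0 := by
  rw [integral_prod _ (integrable_of_continuous_of_zero_off hK hψ hψ0)]
  have h : ∀ t, ∫ x, ψ (t, x) = 0 := fun t =>
    integral_eq_zero_of_hasDerivAt_of_integrable (hd t)
      ((by fun_prop : Continuous fun x => ψ (t, x)).integrable_of_hasCompactSupport
        (hasCompactSupport_slice_right hK hψ0 t))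
      ((by fun_prop : Continuous fun x => φ (t, x)).integrable_of_hasCompactSupport
        (hasCompactSupport_slice_right hK hφ0 t))
  simp [h]

/-- The measure `exp (2 m (x₀ - a)) dx₀` on the half-line `x₀ > 0`. -/
noncomputable def halfLineWeight (m a : ℝ) : Measure ℝ :=
  (volume.restrict (Set.Ioi 0)).withDensity
    fun t => ((Real.exp (2 * m * (t - a))).toNNReal : ENNReal)

noncomputable instance (m a : ℝ) : SFinite (halfLineWeight m a) := by
  unfold halfLineWeight; infer_instance

noncomputable instance (m a : ℝ) : IsLocallyFiniteMeasure (halfLineWeight m a) :=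
  IsLocallyFiniteMeasure.withDensity_coe (by fun_prop)

theorem integral_halfLineWeight (m a : ℝ) (g : ℝ → ℝ) :
    ∫ t, g t ∂(halfLineWeight m a) = ∫ t in Set.Ioi 0, Real.exp (2 * m * (t - a)) * g t := by
  rw [halfLineWeight, integral_withDensity_eq_integral_smul (by fun_prop)]
  refine integral_congr_ae (.of_forall fun t => ?_)
  simp [NNReal.smul_def, Real.coe_toNNReal _ (Real.exp_pos _).le]

theorem integral_halfLineWeight_prod {m a : ℝ} {K : Set (ℝ × ℝ)} (hK : IsCompact K)
    {φ : ℝ × ℝ → ℝ} (hφ : Continuous φ) (hφ0 : ∀ p ∉ K, φ p = 0) :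
    ∫ p, φ p ∂((halfLineWeight m a).prod volume) =
      ∫ t in Set.Ioi 0, Real.exp (2 * m * (t - a)) * ∫ x, φ (t, x) := by
  rw [integral_prod _ (integrable_of_continuous_of_zero_off hK hφ hφ0), integral_halfLineWeight]

theorem integral_dirac_prod {t : ℝ} {K : Set (ℝ × ℝ)} (hK : IsCompact K)
    {φ : ℝ × ℝ → ℝ} (hφ : Continuous φ) (hφ0 : ∀ p ∉ K, φ p = 0) :
    ∫ p, φ p ∂((Measure.dirac t).prod volume) = ∫ x, φ (t, x) := by
  rw [integral_prod _ (integrable_of_continuous_of_zero_off hK hφ hφ0), integral_dirac]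

/-- Integration by parts in `x₀` against the exponential weight on the half-line. -/
theorem integral_halfLineWeight_deriv {m a : ℝ} {K : Set (ℝ × ℝ)} (hK : IsCompact K)
    {φ ψ : ℝ × ℝ → ℝ} (hφ : Continuous φ) (hψ : Continuous ψ)
    (hφ0 : ∀ p ∉ K, φ p = 0) (hψ0 : ∀ p ∉ K, ψ p = 0)
    (hd : ∀ t x, HasDerivAt (fun t => φ (t, x)) (ψ (t, x)) t) :
    2 * m * ∫ p, φ p ∂((halfLineWeight m a).prod volume) +
        ∫ p, ψ p ∂((halfLineWeight m a).prod volume) =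
      -(Real.exp (2 * m * (0 - a)) * ∫ p, φ p ∂((Measure.dirac 0).prod volume)) := by
  set w : ℝ → ℝ := fun t => Real.exp (2 * m * (t - a)) with hw
  have hwc : Continuous w := by fun_prop
  have hwd : ∀ t, HasDerivAt w (2 * m * w t) t := fun t => by
    have := (((hasDerivAt_id t).sub_const a).const_mul (2 * m)).exp
    simpa [hw, mul_comm] using this
  set Φ : ℝ × ℝ → ℝ := fun p => w p.1 * (2 * m * φ p + ψ p) with hΦ
  have hΦc : Continuous Φ := by fun_prop
  have hΦ0 : ∀ p ∉ K, Φ p = 0 := fun p hp => by simp [hΦ, hφ0 p hp, hψ0 p hp]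
  have hint : Integrable Φ ((volume.restrict (Set.Ioi (0 : ℝ))).prod volume) :=
    integrable_of_continuous_of_zero_off hK hΦc hΦ0
  have hslice : ∀ x, ∫ t in Set.Ioi (0 : ℝ), Φ (t, x) = -(w 0 * φ (0, x)) := fun x => by
    have hcs := hasCompactSupport_slice_left hK hφ0 x
    have hcs' := hasCompactSupport_slice_left hK hΦ0 x
    have hd' : ∀ t ∈ Set.Ici (0 : ℝ), HasDerivAt (fun t => w t * φ (t, x)) (Φ (t, x)) t :=
      fun t _ => ((hwd t).mul (hd t x)).congr_deriv (by simp only [hΦ]; ring)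
    have hlim : Filter.Tendsto (fun t => w t * φ (t, x)) Filter.atTop (nhds 0) :=
      ((hcs.mul_left (f := w)).is_zero_at_infty).mono_left
        (by rw [cocompact_eq_atBot_atTop]; exact le_sup_right)
    rw [integral_Ioi_of_hasDerivAt_of_tendsto' hd'
      ((by fun_prop : Continuous fun t => Φ (t, x)).integrable_of_hasCompactSupport
        hcs').integrableOn hlim]
    simp
  have h1 := integrable_of_continuous_of_zero_off (ν := (halfLineWeight m a).prod volume)
    hK hφ hφ0
  have h2 := integrable_of_continuous_of_zero_off (ν := (halfLineWeight m a).prod volume)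
    hK hψ hψ0
  rw [← integral_const_mul, ← integral_add (h1.const_mul _) h2,
    integral_halfLineWeight_prod hK (φ := fun p => 2 * m * φ p + ψ p) (by fun_prop)
      (fun p hp => by simp [hφ0 p hp, hψ0 p hp]), integral_dirac_prod hK hφ hφ0]
  calc ∫ t in Set.Ioi (0 : ℝ), w t * ∫ x, (2 * m * φ (t, x) + ψ (t, x))
      = ∫ t in Set.Ioi (0 : ℝ), ∫ x, Φ (t, x) := by
        refine integral_congr_ae (.of_forall fun t => ?_)
        exact (integral_const_mul _ _).symm
    _ = ∫ x, ∫ t in Set.Ioi (0 : ℝ), Φ (t, x) := integral_integral_swap hint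
    _ = -(w 0 * ∫ x, φ (0, x)) := by
        simp only [hslice, integral_neg, integral_const_mul]

end Integration

section Derivatives

open scoped ContDiff

/-- `∂/∂x₀` -/
noncomputable def partialT (f : ℝ × ℝ → ℂ) : ℝ × ℝ → ℂ := fun p => fderiv ℝ f p (1, 0)

/-- `∂/∂x₁` -/
noncomputable def partialX (f : ℝ × ℝ → ℂ) : ℝ × ℝ → ℂ := fun p => fderiv ℝ f p (0, 1)

/-- Smooth functions vanishing off `K`. -/
structure TestOn (K : Set (ℝ × ℝ)) (f : ℝ × ℝ → ℂ) : Prop where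
  smooth : ContDiff ℝ ∞ f
  zero : ∀ p ∉ K, f p = 0

namespace TestOn

variable {K : Set (ℝ × ℝ)} {f g : ℝ × ℝ → ℂ}

theorem continuous (hf : TestOn K f) : Continuous f := hf.smooth.continuous

theorem differentiable (hf : TestOn K f) : Differentiable ℝ f :=
  hf.smooth.differentiable (by simp)

theorem fderiv_apply (hK : IsClosed K) (hf : TestOn K f) (v : ℝ × ℝ) :
    TestOn K fun p => fderiv ℝ f p v where
  smooth := (hf.smooth.fderiv_right (m := ∞) (by simp)).clm_apply contDiff_const
  zero p hp := by
    have h : f =ᶠ[nhds p] fun _ => 0 :=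
      Filter.eventually_of_mem (hK.isOpen_compl.mem_nhds hp) fun q hq => hf.zero q hq
    simp [h.fderiv_eq]

theorem partialT (hK : IsClosed K) (hf : TestOn K f) : TestOn K (partialT f) :=
  hf.fderiv_apply hK _

theorem partialX (hK : IsClosed K) (hf : TestOn K f) : TestOn K (partialX f) :=
  hf.fderiv_apply hK _

theorem hasDerivAt_fst (hf : TestOn K f) (t x : ℝ) :
    HasDerivAt (fun t => f (t, x)) (_root_.partialT f (t, x)) t :=
  (hf.differentiable (t, x)).hasFDerivAt.comp_hasDerivAt t
    ((hasDerivAt_id t).prodMk (hasDerivAt_const t x))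

theorem hasDerivAt_snd (hf : TestOn K f) (t x : ℝ) :
    HasDerivAt (fun x => f (t, x)) (_root_.partialX f (t, x)) x :=
  (hf.differentiable (t, x)).hasFDerivAt.comp_hasDerivAt x
    ((hasDerivAt_const x t).prodMk (hasDerivAt_id x))

theorem partial_comm (hf : TestOn K f) :
    _root_.partialT (_root_.partialX f) = _root_.partialX (_root_.partialT f) := by
  funext p
  have hd : DifferentiableAt ℝ (fderiv ℝ f) p :=
    ((hf.smooth.fderiv_right (m := ∞) (by simp)).differentiable (by simp)) p
  have hs := (hf.smooth.contDiffAt (x := p)).isSymmSndFDerivAt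
    (by simpa using ENat.LEInfty.out)
  have h : ∀ v w, fderiv ℝ (fun q => fderiv ℝ f q v) p w = fderiv ℝ (fderiv ℝ f) p w v :=
    fun v w => by
      rw [fderiv_clm_apply hd (by fun_prop)]
      simp
  change fderiv ℝ (fun q => fderiv ℝ f q (0, 1)) p (1, 0) =
    fderiv ℝ (fun q => fderiv ℝ f q (1, 0)) p (0, 1)
  rw [h, h]
  exact hs _ _

theorem neg_I_smul (hf : TestOn K f) : TestOn K fun p => -Complex.I * f p where
  smooth := contDiff_const.mul hf.smooth
  zero p hp := by simp [hf.zero p hp]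

end TestOn

theorem D0_eq (f : ℝ × ℝ → ℂ) : D0 f = fun p => -Complex.I * partialT f p := rfl

theorem D1_eq (f : ℝ × ℝ → ℂ) : D1 f = fun p => -Complex.I * partialX f p := rfl

theorem partialT_const_mul {f : ℝ × ℝ → ℂ} (hf : Differentiable ℝ f) (c : ℂ) :
    partialT (fun p => c * f p) = fun p => c * partialT f p := by
  funext p
  simp [partialT, fderiv_const_mul (hf p)]

theorem partialX_const_mul {f : ℝ × ℝ → ℂ} (hf : Differentiable ℝ f) (c : ℂ) :
    partialX (fun p => c * f p) = fun p => c * partialX f p := by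
  funext p
  simp [partialX, fderiv_const_mul (hf p)]

end Derivatives

section Pointwise

/-- The symbol-level energy density (Bézout form of the cubic and its derivative); `A` stands for
`(D₁² + y²) u` and `y` for `x₁ ξₙ`. -/
noncomputable def energyDensity (b y : ℝ) (u ut utt utx A : ℂ) : ℝ :=
  3 * inner ℝ utt utt + 2 * inner ℝ A utt + 2 * inner ℝ utx utx + 2 * y ^ 2 * inner ℝ ut ut
    + inner ℝ A A + 6 * b * y ^ 3 * inner ℝ (Complex.I * u) ut

theorem complex_inner_eq (z w : ℂ) : inner ℝ z w = z.re * w.re + z.im * w.im := by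
  simp [Complex.inner]; ring

theorem complex_sq_norm_eq (z : ℂ) : ‖z‖ ^ 2 = z.re ^ 2 + z.im ^ 2 := by
  rw [Complex.sq_norm, Complex.normSq_apply]; ring

/-- Coercivity of the energy density, up to an `x₁`-derivative and a term of lower order. -/
theorem energyDensity_lower_bound {θ r : ℝ} (hθ0 : 0 < θ) (hθ1 : θ < 1) (hr : 3 * r ^ 2 ≤ 1)
    (y ξ : ℝ) (u ux uxx ut utt utx : ℂ) :
    (1 - θ) / 9 * (‖3 * utt + (-uxx + ((y ^ 2 : ℝ) : ℂ) * u)‖ ^ 2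
        + ‖utt‖ ^ 2 + ‖uxx‖ ^ 2 + y ^ 4 * ‖u‖ ^ 2)
      ≤ energyDensity (2 / 3 * θ * r) y u ut utt utx (-uxx + ((y ^ 2 : ℝ) : ℂ) * u)
        + 4 / 3 * ξ ^ 2 * ‖u‖ ^ 2
        + 4 / 3 * (2 * y * ξ * inner ℝ u ux + y ^ 2 * (inner ℝ u uxx + inner ℝ ux ux)) := by
  have key : energyDensity (2 / 3 * θ * r) y u ut utt utx (-uxx + ((y ^ 2 : ℝ) : ℂ) * u)
        + 4 / 3 * ξ ^ 2 * ‖u‖ ^ 2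
        + 4 / 3 * (2 * y * ξ * inner ℝ u ux + y ^ 2 * (inner ℝ u uxx + inner ℝ ux ux))
      = 1 / 3 * ‖3 * utt + (-uxx + ((y ^ 2 : ℝ) : ℂ) * u)‖ ^ 2 + 2 * ‖utx‖ ^ 2
        + 2 * (1 - θ) * y ^ 2 * ‖ut‖ ^ 2
        + 2 * θ * (y ^ 2 * ‖ut + ((r * y : ℝ) : ℂ) * (Complex.I * u)‖ ^ 2)
        + 2 / 3 * (‖uxx‖ ^ 2 + y ^ 4 * ‖u‖ ^ 2)
        - 2 * θ * r ^ 2 * (y ^ 4 * ‖u‖ ^ 2)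
        + 4 / 3 * ‖(ξ : ℂ) * u + (y : ℂ) * ux‖ ^ 2 := by
    simp only [energyDensity, complex_inner_eq, complex_sq_norm_eq, Complex.add_re,
      Complex.add_im, Complex.mul_re, Complex.mul_im, Complex.neg_re, Complex.neg_im,
      Complex.ofReal_re, Complex.ofReal_im, Complex.I_re, Complex.I_im, Complex.re_ofNat,
      Complex.im_ofNat]
    ring
  have hutt : 81 * ‖utt‖ ^ 2 ≤ 18 * ‖3 * utt + (-uxx + ((y ^ 2 : ℝ) : ℂ) * u)‖ ^ 2
      + 36 * (‖uxx‖ ^ 2 + y ^ 4 * ‖u‖ ^ 2) := by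
    have e1 : 18 * ‖3 * utt + (-uxx + ((y ^ 2 : ℝ) : ℂ) * u)‖ ^ 2
      + 36 * (‖uxx‖ ^ 2 + y ^ 4 * ‖u‖ ^ 2) - 81 * ‖utt‖ ^ 2
      = 9 * ‖3 * utt + 2 * (-uxx + ((y ^ 2 : ℝ) : ℂ) * u)‖ ^ 2
        + 18 * ‖uxx + ((y ^ 2 : ℝ) : ℂ) * u‖ ^ 2 := by
      simp only [complex_sq_norm_eq, Complex.add_re,
        Complex.add_im, Complex.mul_re, Complex.mul_im, Complex.neg_re, Complex.neg_im,
        Complex.ofReal_re, Complex.ofReal_im, Complex.re_ofNat, Complex.im_ofNat]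
      ring
    have : 0 ≤ 9 * ‖3 * utt + 2 * (-uxx + ((y ^ 2 : ℝ) : ℂ) * u)‖ ^ 2
        + 18 * ‖uxx + ((y ^ 2 : ℝ) : ℂ) * u‖ ^ 2 := by positivity
    linarith
  rw [key]
  have hθ : 0 < 1 - θ := by linarith
  have h1 : 0 ≤ 2 * (1 - θ) * y ^ 2 * ‖ut‖ ^ 2 := by positivity
  have h2 : 0 ≤ 2 * θ * (y ^ 2 * ‖ut + ((r * y : ℝ) : ℂ) * (Complex.I * u)‖ ^ 2) := by positivity
  have h3 : 0 ≤ ‖(ξ : ℂ) * u + (y : ℂ) * ux‖ ^ 2 := by positivity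
  have h4 : 0 ≤ ‖utx‖ ^ 2 := by positivity
  have hyu : 0 ≤ y ^ 4 * ‖u‖ ^ 2 := by positivity
  have hw : 0 ≤ ‖3 * utt + (-uxx + ((y ^ 2 : ℝ) : ℂ) * u)‖ ^ 2 := by positivity
  have huxx : 0 ≤ ‖uxx‖ ^ 2 := by positivity
  generalize ‖3 * utt + (-uxx + ((y ^ 2 : ℝ) : ℂ) * u)‖ ^ 2 = w at *
  generalize y ^ 4 * ‖u‖ ^ 2 = v at *
  have h5 : θ * (3 * r ^ 2) * v ≤ θ * 1 * v := by gcongr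
  have h6 := mul_le_mul_of_nonneg_left hutt hθ.le
  have h7 : 0 ≤ θ * w := by positivity
  have h8 := mul_nonneg hθ.le hyu
  have h9 := mul_nonneg hθ.le huxx
  have h10 : 0 ≤ θ * ‖uxx‖ ^ 2 := by positivity
  have h11 := mul_nonneg hθ.le hw
  nlinarith

/-- The `x₀`-derivative of the energy density, written out through the product rule, in terms of
the operator, an `x₁`-derivative and a commutator term. -/
theorem energyDensity_deriv_eq (b y ξ : ℝ) (u ux uxx ut utt uttt utx utxx uttx : ℂ) :
    3 * (inner ℝ utt uttt + inner ℝ uttt utt)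
      + 2 * (inner ℝ (-uxx + ((y ^ 2 : ℝ) : ℂ) * u) uttt
        + inner ℝ (-utxx + ((y ^ 2 : ℝ) : ℂ) * ut) utt)
      + 2 * (inner ℝ utx uttx + inner ℝ uttx utx)
      + 2 * y ^ 2 * (inner ℝ ut utt + inner ℝ utt ut)
      + (inner ℝ (-uxx + ((y ^ 2 : ℝ) : ℂ) * u) (-utxx + ((y ^ 2 : ℝ) : ℂ) * ut)
        + inner ℝ (-utxx + ((y ^ 2 : ℝ) : ℂ) * ut) (-uxx + ((y ^ 2 : ℝ) : ℂ) * u))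
      + 6 * b * y ^ 3 * (inner ℝ (Complex.I * u) utt + inner ℝ (Complex.I * ut) ut)
      = 2 * inner ℝ (3 * utt + (-uxx + ((y ^ 2 : ℝ) : ℂ) * u))
          (uttt + (-utxx + ((y ^ 2 : ℝ) : ℂ) * ut) + Complex.I * (((b * y ^ 3 : ℝ) : ℂ) * u))
        + 6 * b * ξ * y ^ 2 * inner ℝ (Complex.I * ux) u
        + (4 * (inner ℝ utx uttx + inner ℝ utxx utt)
          - 2 * b * (3 * y ^ 2 * ξ * inner ℝ (Complex.I * ux) u
            + y ^ 3 * (inner ℝ (Complex.I * ux) ux + inner ℝ (Complex.I * uxx) u))) := by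
  simp only [complex_inner_eq, Complex.add_re,
    Complex.add_im, Complex.mul_re, Complex.mul_im, Complex.neg_re, Complex.neg_im,
    Complex.ofReal_re, Complex.ofReal_im, Complex.I_re, Complex.I_im, Complex.re_ofNat,
    Complex.im_ofNat]
  ring

theorem two_inner_lower_bound {k : ℝ} (hk : 0 < k) (w g : ℂ) :
    0 ≤ k * ‖w‖ ^ 2 + 1 / k * ‖g‖ ^ 2 + 2 * inner ℝ w g := by
  have : k * ‖w‖ ^ 2 + 1 / k * ‖g‖ ^ 2 + 2 * inner ℝ w g
      = 1 / k * ‖(k : ℂ) * w + g‖ ^ 2 := by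
    simp only [complex_inner_eq, complex_sq_norm_eq, Complex.add_re, Complex.add_im,
      Complex.mul_re, Complex.mul_im, Complex.ofReal_re, Complex.ofReal_im]
    field_simp
    ring
  rw [this]; positivity

theorem commutator_lower_bound {b m : ℝ} (hb : |b| ≤ 1 / 2) (hm : 0 < m) (y ξ : ℝ) (u ux : ℂ) :
    0 ≤ 3 / 2 * |ξ| / m * (y ^ 4 * ‖u‖ ^ 2) + 3 / 2 * |ξ| * m * ‖ux‖ ^ 2
      + 6 * b * ξ * y ^ 2 * inner ℝ (Complex.I * ux) u := by
  have h1 : |6 * b * ξ * y ^ 2 * inner ℝ (Complex.I * ux) u| ≤ 3 * |ξ| * (y ^ 2 * ‖u‖ * ‖ux‖) := by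
    have h := abs_real_inner_le_norm (Complex.I * ux) u
    rw [norm_mul, Complex.norm_I, one_mul] at h
    rw [abs_mul, abs_mul, abs_mul, abs_mul, abs_of_nonneg (sq_nonneg y),
      abs_of_pos (by norm_num : (0 : ℝ) < 6)]
    calc 6 * |b| * |ξ| * y ^ 2 * |inner ℝ (Complex.I * ux) u|
        ≤ 6 * (1 / 2) * |ξ| * y ^ 2 * (‖ux‖ * ‖u‖) := by gcongr
      _ = _ := by ring
  have h2 : 3 / 2 * |ξ| / m * (y ^ 4 * ‖u‖ ^ 2) + 3 / 2 * |ξ| * m * ‖ux‖ ^ 2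
      - 3 * |ξ| * (y ^ 2 * ‖u‖ * ‖ux‖) = 3 / 2 * |ξ| / m * (y ^ 2 * ‖u‖ - m * ‖ux‖) ^ 2 := by
    field_simp
    ring
  have h3 : 0 ≤ 3 / 2 * |ξ| / m * (y ^ 2 * ‖u‖ - m * ‖ux‖) ^ 2 := by positivity
  linarith [neg_abs_le (6 * b * ξ * y ^ 2 * inner ℝ (Complex.I * ux) u)]

end Pointwise

section Integrated

variable {K : Set (ℝ × ℝ)} {u : ℝ × ℝ → ℂ}

/-- `(D₁² + x₁² ξₙ²) u` -/
noncomputable def oscillator (ξ : ℝ) (u : ℝ × ℝ → ℂ) : ℝ × ℝ → ℂ :=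
  fun p => -partialX (partialX u) p + (((p.2 * ξ) ^ 2 : ℝ) : ℂ) * u p

theorem TestOn.integrable_sq {ν : Measure (ℝ × ℝ)} [IsFiniteMeasureOnCompacts ν]
    (hK : IsCompact K) (hu : TestOn K u) : Integrable (fun p => ‖u p‖ ^ 2) ν :=
  integrable_of_continuous_of_zero_off hK (by have := hu.continuous; fun_prop)
    fun p hp => by simp [hu.zero p hp]

theorem TestOn.integrable_weight_sq {ν : Measure (ℝ × ℝ)} [IsFiniteMeasureOnCompacts ν]
    (hK : IsCompact K) (hu : TestOn K u) (ξ : ℝ) (n : ℕ) :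
    Integrable (fun p => (p.2 * ξ) ^ n * ‖u p‖ ^ 2) ν :=
  integrable_of_continuous_of_zero_off hK (by have := hu.continuous; fun_prop)
    fun p hp => by simp [hu.zero p hp]

theorem TestOn.oscillator (hK : IsClosed K) (hu : TestOn K u) (ξ : ℝ) :
    TestOn K (oscillator ξ u) where
  smooth := by
    have h := ((hu.partialX hK).partialX hK).smooth
    have h' := hu.smooth
    have h'' : ContDiff ℝ (⊤ : ℕ∞) fun p : ℝ × ℝ => (((p.2 * ξ) ^ 2 : ℝ) : ℂ) :=
      Complex.ofRealCLM.contDiff.comp ((contDiff_snd.mul contDiff_const).pow 2)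
    exact h.neg.add (h''.mul h')
  zero p hp := by
    simp [_root_.oscillator, hu.zero p hp, ((hu.partialX hK).partialX hK).zero p hp]

theorem TestOn.partialT_oscillator (hK : IsClosed K) (hu : TestOn K u) (ξ : ℝ) (t x : ℝ) :
    HasDerivAt (fun t => _root_.oscillator ξ u (t, x))
      (_root_.oscillator ξ (_root_.partialT u) (t, x)) t := by
  have h := ((hu.partialX hK).partialX hK).hasDerivAt_fst t x
  rw [(hu.partialX hK).partial_comm, hu.partial_comm] at h
  exact h.neg.add ((hu.hasDerivAt_fst t x).const_mul (((x * ξ) ^ 2 : ℝ) : ℂ))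

theorem weight_interpolation {ν : Measure (ℝ × ℝ)} [IsFiniteMeasureOnCompacts ν]
    (hK : IsCompact K) (hu : TestOn K u) (m ξ : ℝ) :
    m ^ 2 * ∫ p, (p.2 * ξ) ^ 2 * ‖u p‖ ^ 2 ∂ν ≤
      1 / 2 * ∫ p, (p.2 * ξ) ^ 4 * ‖u p‖ ^ 2 ∂ν
        + 1 / 2 * m ^ 4 * ∫ p, ‖u p‖ ^ 2 ∂ν := by
  have h := integral_linearCombination_nonneg (ν := ν)
    ![1 / 2, 1 / 2 * m ^ 4, -m ^ 2]
    ![fun p => (p.2 * ξ) ^ 4 * ‖u p‖ ^ 2, fun p => ‖u p‖ ^ 2, fun p => (p.2 * ξ) ^ 2 * ‖u p‖ ^ 2]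
    (by
      intro i
      fin_cases i
      exacts [hu.integrable_weight_sq hK ξ 4, hu.integrable_sq hK, hu.integrable_weight_sq hK ξ 2])
    (by
      intro p
      simp only [Fin.sum_univ_three, Matrix.cons_val]
      have : 0 ≤ 1 / 2 * (((p.2 * ξ) ^ 2 - m ^ 2) * ‖u p‖) ^ 2 := by positivity
      refine this.trans_eq ?_
      ring)
  simp only [Fin.sum_univ_three, Matrix.cons_val] at h
  linarith

variable {ρ : Measure ℝ} [SFinite ρ] [IsLocallyFiniteMeasure ρ]

theorem partialX_interpolation (hK : IsCompact K) (hu : TestOn K u) (m : ℝ) :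
    m ^ 2 * ∫ p, ‖partialX u p‖ ^ 2 ∂(ρ.prod volume) ≤
      1 / 2 * ∫ p, ‖partialX (partialX u) p‖ ^ 2 ∂(ρ.prod volume)
        + 1 / 2 * m ^ 4 * ∫ p, ‖u p‖ ^ 2 ∂(ρ.prod volume) := by
  have hx := hu.partialX hK.isClosed
  have hxx := hx.partialX hK.isClosed
  have cu := hu.continuous
  have cx := hx.continuous
  have cxx := hxx.continuous
  set ψ : ℝ × ℝ → ℝ := fun p =>
    inner ℝ (u p) (partialX (partialX u) p) + inner ℝ (partialX u p) (partialX u p) with hψ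
  have hψc : Continuous ψ := by fun_prop
  have hψ0 : ∀ p ∉ K, ψ p = 0 := fun p hp => by simp [hψ, hu.zero p hp, hx.zero p hp]
  have hzero : ∫ p, ψ p ∂(ρ.prod volume) = 0 :=
    integral_prod_deriv_snd_eq_zero hK (φ := fun p => inner ℝ (u p) (partialX u p))
      (by fun_prop) hψc (fun p hp => by simp [hu.zero p hp]) hψ0
      fun t x => (hu.hasDerivAt_snd t x).inner ℝ (hx.hasDerivAt_snd t x)
  have h := integral_linearCombination_nonneg (ν := ρ.prod volume)
    ![1 / 2, 1 / 2 * m ^ 4, -m ^ 2, m ^ 2]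
    ![fun p => ‖partialX (partialX u) p‖ ^ 2, fun p => ‖u p‖ ^ 2, fun p => ‖partialX u p‖ ^ 2, ψ]
    (by
      intro i
      fin_cases i
      exacts [hxx.integrable_sq hK, hu.integrable_sq hK, hx.integrable_sq hK,
        integrable_of_continuous_of_zero_off hK hψc hψ0])
    (by
      intro p
      simp only [Fin.sum_univ_four, Matrix.cons_val]
      have : 0 ≤ 1 / 2 * ‖partialX (partialX u) p + ((m ^ 2 : ℝ) : ℂ) * u p‖ ^ 2 := by positivity
      refine this.trans_eq ?_
      simp only [hψ, complex_inner_eq, complex_sq_norm_eq, Complex.add_re, Complex.add_im,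
        Complex.mul_re, Complex.mul_im, Complex.ofReal_re, Complex.ofReal_im]
      ring)
  simp only [Fin.sum_univ_four, Matrix.cons_val, hzero] at h
  linarith

/-- The energy density of `u`. -/
noncomputable def energy (b ξ : ℝ) (u : ℝ × ℝ → ℂ) : ℝ × ℝ → ℝ := fun p =>
  energyDensity b (p.2 * ξ) (u p) (partialT u p) (partialT (partialT u) p)
    (partialX (partialT u) p) (oscillator ξ u p)

/-- The multiplier of the energy method: up to sign, the `D₀`-derivative of the symbol of `P`
applied to `u`. -/
noncomputable def multiplier (ξ : ℝ) (u : ℝ × ℝ → ℂ) : ℝ × ℝ → ℂ := fun p =>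
  3 * partialT (partialT u) p + oscillator ξ u p

/-- The operator `P`, up to a factor `i`. -/
noncomputable def cubicOperator (b ξ : ℝ) (u : ℝ × ℝ → ℂ) : ℝ × ℝ → ℂ := fun p =>
  partialT (partialT (partialT u)) p + oscillator ξ (partialT u) p
    + Complex.I * (((b * (p.2 * ξ) ^ 3 : ℝ) : ℂ) * u p)

theorem energy_continuous (hK : IsClosed K) (hu : TestOn K u) (b ξ : ℝ) :
    Continuous (energy b ξ u) := by
  have c := hu.continuous
  have ct := (hu.partialT hK).continuous
  have ctt := ((hu.partialT hK).partialT hK).continuous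
  have ctx := ((hu.partialT hK).partialX hK).continuous
  have cA := (hu.oscillator hK ξ).continuous
  unfold energy energyDensity
  fun_prop

theorem energy_zero (hK : IsClosed K) (hu : TestOn K u) (b ξ : ℝ) :
    ∀ p ∉ K, energy b ξ u p = 0 := fun p hp => by
  have ht := hu.partialT hK
  simp [energy, energyDensity, hu.zero p hp, ht.zero p hp, (ht.partialT hK).zero p hp,
    (ht.partialX hK).zero p hp, (hu.oscillator hK ξ).zero p hp]

theorem multiplier_integrable_sq {ν : Measure (ℝ × ℝ)} [IsFiniteMeasureOnCompacts ν]
    (hK : IsCompact K) (hu : TestOn K u) (ξ : ℝ) :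
    Integrable (fun p => ‖multiplier ξ u p‖ ^ 2) ν := by
  have htt := (hu.partialT hK.isClosed).partialT hK.isClosed
  have hA := hu.oscillator hK.isClosed ξ
  have ctt := htt.continuous
  have cA := hA.continuous
  refine integrable_of_continuous_of_zero_off hK (by unfold multiplier; fun_prop)
    fun p hp => by simp [multiplier, htt.zero p hp, hA.zero p hp]

theorem cubicOperator_continuous (hK : IsClosed K) (hu : TestOn K u) (b ξ : ℝ) :
    Continuous (cubicOperator b ξ u) := by
  have c := hu.continuous
  have cttt := (((hu.partialT hK).partialT hK).partialT hK).continuous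
  have cA := ((hu.partialT hK).oscillator hK ξ).continuous
  unfold cubicOperator
  fun_prop

theorem cubicOperator_zero (hK : IsClosed K) (hu : TestOn K u) (b ξ : ℝ) :
    ∀ p ∉ K, cubicOperator b ξ u p = 0 := fun p hp => by
  simp [cubicOperator, hu.zero p hp, ((hu.partialT hK).oscillator hK ξ).zero p hp,
    (((hu.partialT hK).partialT hK).partialT hK).zero p hp]

theorem energy_integral_lower_bound {θ r : ℝ} (hθ0 : 0 < θ) (hθ1 : θ < 1) (hr : 3 * r ^ 2 ≤ 1)
    (hK : IsCompact K) (hu : TestOn K u) (ξ : ℝ) :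
    (1 - θ) / 9 * (∫ p, ‖multiplier ξ u p‖ ^ 2 ∂(ρ.prod volume)
        + ∫ p, ‖partialT (partialT u) p‖ ^ 2 ∂(ρ.prod volume)
        + ∫ p, ‖partialX (partialX u) p‖ ^ 2 ∂(ρ.prod volume)
        + ∫ p, (p.2 * ξ) ^ 4 * ‖u p‖ ^ 2 ∂(ρ.prod volume))
      ≤ ∫ p, energy (2 / 3 * θ * r) ξ u p ∂(ρ.prod volume)
        + 4 / 3 * ξ ^ 2 * ∫ p, ‖u p‖ ^ 2 ∂(ρ.prod volume) := by
  have hKc := hK.isClosed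
  have hx := hu.partialX hKc
  have hxx := hx.partialX hKc
  have cu := hu.continuous
  have cx := hx.continuous
  have cxx := hxx.continuous
  set ψ : ℝ × ℝ → ℝ := fun p =>
    2 * (p.2 * ξ) * ξ * inner ℝ (u p) (partialX u p) + (p.2 * ξ) ^ 2 *
      (inner ℝ (u p) (partialX (partialX u) p) + inner ℝ (partialX u p) (partialX u p)) with hψ
  have hψc : Continuous ψ := by fun_prop
  have hψ0 : ∀ p ∉ K, ψ p = 0 := fun p hp => by simp [hψ, hu.zero p hp, hx.zero p hp]
  have hzero : ∫ p, ψ p ∂(ρ.prod volume) = 0 := by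
    refine integral_prod_deriv_snd_eq_zero hK
      (φ := fun p => (p.2 * ξ) ^ 2 * inner ℝ (u p) (partialX u p))
      (by fun_prop) hψc (fun p hp => by simp [hu.zero p hp]) hψ0 fun t x => ?_
    have hd := (((hasDerivAt_id' x).mul_const ξ).pow 2).mul
      ((hu.hasDerivAt_snd t x).inner ℝ (hx.hasDerivAt_snd t x))
    exact hd.congr_deriv (by simp [hψ])
  have h := integral_linearCombination_nonneg (ν := ρ.prod volume)
    ![1, 4 / 3 * ξ ^ 2, 4 / 3, -((1 - θ) / 9), -((1 - θ) / 9), -((1 - θ) / 9), -((1 - θ) / 9)]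
    ![energy (2 / 3 * θ * r) ξ u, fun p => ‖u p‖ ^ 2, ψ, fun p => ‖multiplier ξ u p‖ ^ 2,
      fun p => ‖partialT (partialT u) p‖ ^ 2, fun p => ‖partialX (partialX u) p‖ ^ 2,
      fun p => (p.2 * ξ) ^ 4 * ‖u p‖ ^ 2]
    (by
      intro i
      fin_cases i
      exacts [integrable_of_continuous_of_zero_off hK (energy_continuous hKc hu _ _)
          (energy_zero hKc hu _ _), hu.integrable_sq hK,
        integrable_of_continuous_of_zero_off hK hψc hψ0, multiplier_integrable_sq hK hu ξ,
        ((hu.partialT hKc).partialT hKc).integrable_sq hK, hxx.integrable_sq hK,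
        hu.integrable_weight_sq hK ξ 4])
    (by
      intro p
      simp only [Fin.sum_univ_seven, Matrix.cons_val]
      have := energyDensity_lower_bound hθ0 hθ1 hr (p.2 * ξ) ξ (u p) (partialX u p)
        (partialX (partialX u) p) (partialT u p) (partialT (partialT u) p)
        (partialX (partialT u) p)
      simp only [energy, multiplier, oscillator, hψ]
      linarith)
  simp only [Fin.sum_univ_seven, Matrix.cons_val, hzero] at h
  linarith

theorem exponential_weight_inequality (hK : IsCompact K) (hu : TestOn K u) (m a : ℝ) :
    m * (Real.exp (2 * m * (0 - a)) * ∫ p, ‖u p‖ ^ 2 ∂((Measure.dirac 0).prod volume))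
        + m ^ 2 * ∫ p, ‖u p‖ ^ 2 ∂((halfLineWeight m a).prod volume)
      ≤ ∫ p, ‖partialT u p‖ ^ 2 ∂((halfLineWeight m a).prod volume) := by
  have ht := hu.partialT hK.isClosed
  have cu := hu.continuous
  have ct := ht.continuous
  set ψ : ℝ × ℝ → ℝ := fun p => 2 * inner ℝ (u p) (partialT u p) with hψ
  have hψc : Continuous ψ := by fun_prop
  have hψ0 : ∀ p ∉ K, ψ p = 0 := fun p hp => by simp [hψ, hu.zero p hp]
  have hibp := integral_halfLineWeight_deriv (m := m) (a := a) hK (φ := fun p => ‖u p‖ ^ 2)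
    (by fun_prop) hψc (fun p hp => by simp [hu.zero p hp]) hψ0
    fun t x => (hu.hasDerivAt_fst t x).norm_sq
  have h := integral_linearCombination_nonneg (ν := (halfLineWeight m a).prod volume)
    ![1, m ^ 2, m]
    ![fun p => ‖partialT u p‖ ^ 2, fun p => ‖u p‖ ^ 2, ψ]
    (by
      intro i
      fin_cases i
      exacts [ht.integrable_sq hK, hu.integrable_sq hK,
        integrable_of_continuous_of_zero_off hK hψc hψ0])
    (by
      intro p
      simp only [Fin.sum_univ_three, Matrix.cons_val]
      have : 0 ≤ ‖partialT u p + (m : ℂ) * u p‖ ^ 2 := by positivity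
      refine this.trans_eq ?_
      simp only [hψ, complex_inner_eq, complex_sq_norm_eq, Complex.add_re, Complex.add_im,
        Complex.mul_re, Complex.mul_im, Complex.ofReal_re, Complex.ofReal_im]
      ring)
  simp only [Fin.sum_univ_three, Matrix.cons_val] at h
  have h' := congrArg (fun z => m * z) hibp
  linarith

theorem energy_estimate {b m c : ℝ} (hb : |b| ≤ 1 / 2) (hm : 0 < m) (hc : 0 < c) (a ξ : ℝ)
    (hK : IsCompact K) (hu : TestOn K u) :
    Real.exp (2 * m * (0 - a)) * (∫ p, energy b ξ u p ∂((Measure.dirac 0).prod volume))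
        + 2 * m * ∫ p, energy b ξ u p ∂((halfLineWeight m a).prod volume)
      ≤ c * m * ∫ p, ‖multiplier ξ u p‖ ^ 2 ∂((halfLineWeight m a).prod volume)
        + 1 / (c * m) * ∫ p, ‖cubicOperator b ξ u p‖ ^ 2 ∂((halfLineWeight m a).prod volume)
        + 3 / 2 * |ξ| / m * ∫ p, (p.2 * ξ) ^ 4 * ‖u p‖ ^ 2 ∂((halfLineWeight m a).prod volume)
        + 3 / 2 * |ξ| * m * ∫ p, ‖partialX u p‖ ^ 2 ∂((halfLineWeight m a).prod volume) := by
  have hKc := hK.isClosed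
  have hx := hu.partialX hKc
  have hxx := hx.partialX hKc
  have ht := hu.partialT hKc
  have htt := ht.partialT hKc
  have httt := htt.partialT hKc
  have htx := ht.partialX hKc
  have htxx := htx.partialX hKc
  have httx := htt.partialX hKc
  have hA := hu.oscillator hKc ξ
  have hAt := ht.oscillator hKc ξ
  have cu := hu.continuous
  have cx := hx.continuous
  have cxx := hxx.continuous
  have ct := ht.continuous
  have ctt := htt.continuous
  have cttt := httt.continuous
  have ctx := htx.continuous
  have ctxx := htxx.continuous
  have cttx := httx.continuous
  have cA := hA.continuous
  have cAt := hAt.continuous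
  have cG := cubicOperator_continuous hKc hu b ξ
  set F : ℝ × ℝ → ℝ := fun p =>
    4 * (inner ℝ (partialX (partialT u) p) (partialX (partialT (partialT u)) p)
        + inner ℝ (partialX (partialX (partialT u)) p) (partialT (partialT u) p))
      - 2 * b * (3 * (p.2 * ξ) ^ 2 * ξ * inner ℝ (Complex.I * partialX u p) (u p)
        + (p.2 * ξ) ^ 3 * (inner ℝ (Complex.I * partialX u p) (partialX u p)
          + inner ℝ (Complex.I * partialX (partialX u) p) (u p))) with hF
  have hFc : Continuous F := by fun_prop
  have hF0 : ∀ p ∉ K, F p = 0 := fun p hp => by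
    simp [hF, hu.zero p hp, hx.zero p hp, htx.zero p hp, htt.zero p hp]
  have hFzero : ∫ p, F p ∂((halfLineWeight m a).prod volume) = 0 := by
    refine integral_prod_deriv_snd_eq_zero hK
      (φ := fun p => 4 * inner ℝ (partialX (partialT u) p) (partialT (partialT u) p)
        - 2 * b * ((p.2 * ξ) ^ 3 * inner ℝ (Complex.I * partialX u p) (u p)))
      (by fun_prop) hFc (fun p hp => by simp [hu.zero p hp, htx.zero p hp]) hF0 fun t x => ?_
    have hd := (((htx.hasDerivAt_snd t x).inner ℝ (htt.hasDerivAt_snd t x)).const_mul 4).sub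
      (((((hasDerivAt_id' x).mul_const ξ).pow 3).mul
        (((hx.hasDerivAt_snd t x).const_mul Complex.I).inner ℝ
          (hu.hasDerivAt_snd t x))).const_mul (2 * b))
    exact hd.congr_deriv (by simp [hF])
  set E' : ℝ × ℝ → ℝ := fun p =>
    3 * (inner ℝ (partialT (partialT u) p) (partialT (partialT (partialT u)) p)
        + inner ℝ (partialT (partialT (partialT u)) p) (partialT (partialT u) p))
      + 2 * (inner ℝ (oscillator ξ u p) (partialT (partialT (partialT u)) p)
        + inner ℝ (oscillator ξ (partialT u) p) (partialT (partialT u) p))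
      + 2 * (inner ℝ (partialX (partialT u) p) (partialX (partialT (partialT u)) p)
        + inner ℝ (partialX (partialT (partialT u)) p) (partialX (partialT u) p))
      + 2 * (p.2 * ξ) ^ 2 * (inner ℝ (partialT u p) (partialT (partialT u) p)
        + inner ℝ (partialT (partialT u) p) (partialT u p))
      + (inner ℝ (oscillator ξ u p) (oscillator ξ (partialT u) p)
        + inner ℝ (oscillator ξ (partialT u) p) (oscillator ξ u p))
      + 6 * b * (p.2 * ξ) ^ 3 * (inner ℝ (Complex.I * u p) (partialT (partialT u) p)
        + inner ℝ (Complex.I * partialT u p) (partialT u p)) with hE'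
  have hE'c : Continuous E' := by fun_prop
  have hE'0 : ∀ p ∉ K, E' p = 0 := fun p hp => by
    simp [hE', hu.zero p hp, ht.zero p hp, htx.zero p hp, htt.zero p hp, hA.zero p hp]
  have hibp := integral_halfLineWeight_deriv (m := m) (a := a) hK
    (energy_continuous hKc hu b ξ) hE'c (energy_zero hKc hu b ξ) hE'0 fun t x => by
      have dA := hu.partialT_oscillator hKc ξ t x
      have dt := ht.hasDerivAt_fst t x
      have dtt := htt.hasDerivAt_fst t x
      have dtx := htx.hasDerivAt_fst t x
      rw [ht.partial_comm] at dtx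
      exact ((((((dtt.inner ℝ dtt).const_mul 3).add ((dA.inner ℝ dtt).const_mul 2)).add
        ((dtx.inner ℝ dtx).const_mul 2)).add ((dt.inner ℝ dt).const_mul (2 * (x * ξ) ^ 2))).add
        (dA.inner ℝ dA)).add
        ((((hu.hasDerivAt_fst t x).const_mul Complex.I).inner ℝ dt).const_mul
          (6 * b * (x * ξ) ^ 3))
  have h := integral_linearCombination_nonneg (ν := (halfLineWeight m a).prod volume)
    ![c * m, 1 / (c * m), 3 / 2 * |ξ| / m, 3 / 2 * |ξ| * m, 1, -1]
    ![fun p => ‖multiplier ξ u p‖ ^ 2, fun p => ‖cubicOperator b ξ u p‖ ^ 2,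
      fun p => (p.2 * ξ) ^ 4 * ‖u p‖ ^ 2, fun p => ‖partialX u p‖ ^ 2, E', F]
    (by
      intro i
      fin_cases i
      exacts [multiplier_integrable_sq hK hu ξ,
        integrable_of_continuous_of_zero_off hK (cG.norm.pow 2)
          fun p hp => by simp [cubicOperator_zero hKc hu b ξ p hp],
        hu.integrable_weight_sq hK ξ 4, hx.integrable_sq hK,
        integrable_of_continuous_of_zero_off hK hE'c hE'0,
        integrable_of_continuous_of_zero_off hK hFc hF0])
    (by
      intro p
      simp only [Fin.sum_univ_six, Matrix.cons_val]
      have h1 := energyDensity_deriv_eq b (p.2 * ξ) ξ (u p) (partialX u p)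
        (partialX (partialX u) p) (partialT u p) (partialT (partialT u) p)
        (partialT (partialT (partialT u)) p) (partialX (partialT u) p)
        (partialX (partialX (partialT u)) p) (partialX (partialT (partialT u)) p)
      have h2 := two_inner_lower_bound (mul_pos hc hm) (multiplier ξ u p) (cubicOperator b ξ u p)
      have h3 := commutator_lower_bound hb hm (p.2 * ξ) ξ (u p) (partialX u p)
      simp only [hE', hF, multiplier, cubicOperator, oscillator] at h2 ⊢
      linarith)
  simp only [Fin.sum_univ_six, Matrix.cons_val, hFzero] at h
  linarith

end Integrated

section Assembly

/-- The absorption argument: combining the energy estimate, its coercivity, the interpolation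
inequalities and the exponential weight inequalities. The variables `B` are boundary
terms and the variables `J` interior ones. -/
theorem absorb_lower_order {c ε m X Ju Jt Jtt Jx Jxx Jy Jyy Jw Jg Je : ℝ}
    {Bu Bt Btt Bx Bxx By Byy Bw Be : ℝ}
    (hc : 0 < c) (hc1 : c ≤ 1) (hε : 0 < ε) (hεc : 5 * ε ≤ c) (hm : 0 < m)
    (hX0 : 0 ≤ X) (hX : X ≤ ε * m ^ 2)
    (hJu : 0 ≤ Ju) (hJtt : 0 ≤ Jtt) (hJx : 0 ≤ Jx) (hJxx : 0 ≤ Jxx) (hJyy : 0 ≤ Jyy)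
    (hJw : 0 ≤ Jw)
    (hBu : 0 ≤ Bu) (hBt : 0 ≤ Bt) (hBtt : 0 ≤ Btt) (hBxx : 0 ≤ Bxx) (hByy : 0 ≤ Byy)
    (hBw : 0 ≤ Bw)
    (hJe : c * (Jw + Jtt + Jxx + Jyy) ≤ Je + 4 / 3 * X ^ 2 * Ju)
    (hBe : c * (Bw + Btt + Bxx + Byy) ≤ Be + 4 / 3 * X ^ 2 * Bu)
    (hest : Be + 2 * m * Je ≤ c * m * Jw + 1 / (c * m) * Jg + 3 / 2 * X / m * Jyy
      + 3 / 2 * X * m * Jx)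
    (hJx' : m ^ 2 * Jx ≤ 1 / 2 * Jxx + 1 / 2 * m ^ 4 * Ju)
    (hBx' : m ^ 2 * Bx ≤ 1 / 2 * Bxx + 1 / 2 * m ^ 4 * Bu)
    (hJy' : m ^ 2 * Jy ≤ 1 / 2 * Jyy + 1 / 2 * m ^ 4 * Ju)
    (hBy' : m ^ 2 * By ≤ 1 / 2 * Byy + 1 / 2 * m ^ 4 * Bu)
    (hu : m * Bu + m ^ 2 * Ju ≤ Jt) (ht : m * Bt + m ^ 2 * Jt ≤ Jtt) :
    c ^ 2 / 7 * ((m ^ 5 * (3 * Bu) + m ^ 3 * (Bt + Bx + By) + m * (Btt + Bxx + Byy))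
      + (m ^ 6 * (3 * Ju) + m ^ 4 * (Jt + Jx + Jy) + m ^ 2 * (Jtt + Jxx + Jyy))) ≤ Jg := by
  set S := m * (Btt + Bxx + Byy) + m ^ 2 * (Jtt + Jxx + Jyy) with hS
  have hε1 : ε ≤ 1 / 5 := by linarith
  have hX2 : X ^ 2 ≤ ε * m ^ 4 * (1 / 5) := by
    calc X ^ 2 ≤ (ε * m ^ 2) ^ 2 := by gcongr
      _ = ε * m ^ 4 * ε := by ring
      _ ≤ _ := by gcongr
  have ht' : m ^ 3 * Bt + m ^ 4 * Jt ≤ m ^ 2 * Jtt := by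
    have := mul_le_mul_of_nonneg_left ht (sq_nonneg m)
    linarith
  have hu' : m ^ 5 * Bu + m ^ 6 * Ju ≤ m ^ 2 * Jtt := by
    have := mul_le_mul_of_nonneg_left hu (pow_nonneg hm.le 4)
    have : 0 ≤ m ^ 3 * Bt := by positivity
    linarith
  have hXu : m * (X ^ 2 * Bu) + 2 * m ^ 2 * (X ^ 2 * Ju) ≤ 2 / 5 * ε * (m ^ 2 * Jtt) := by
    have h1 : m * (X ^ 2 * Bu) ≤ m * (ε * m ^ 4 * (1 / 5) * Bu) := by gcongr
    have h2 : 2 * m ^ 2 * (X ^ 2 * Ju) ≤ 2 * m ^ 2 * (ε * m ^ 4 * (1 / 5) * Ju) := by gcongr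
    have h3 := mul_le_mul_of_nonneg_left hu' hε.le
    have h4 : 0 ≤ ε * (m ^ 5 * Bu) := by positivity
    linarith
  have hcomm : m * (3 / 2 * X / m * Jyy) + m * (3 / 2 * X * m * Jx)
      ≤ 3 / 2 * ε * (m ^ 2 * (Jyy + 1 / 2 * Jxx) + 1 / 2 * (m ^ 2 * Jtt)) := by
    have h1 : m * (3 / 2 * X / m * Jyy) + m * (3 / 2 * X * m * Jx)
        = 3 / 2 * X * (Jyy + m ^ 2 * Jx) := by field_simp
    rw [h1]
    calc 3 / 2 * X * (Jyy + m ^ 2 * Jx) ≤ 3 / 2 * (ε * m ^ 2) * (Jyy + m ^ 2 * Jx) := by gcongr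
      _ = 3 / 2 * ε * (m ^ 2 * Jyy + m ^ 2 * (m ^ 2 * Jx)) := by ring
      _ ≤ _ := by
        have h2 := mul_le_mul_of_nonneg_left hJx' (sq_nonneg m)
        have h3 : 0 ≤ m ^ 5 * Bu := by positivity
        exact mul_le_mul_of_nonneg_left (by linarith) (by positivity)
  have hg : m * (1 / (c * m) * Jg) = Jg / c := by field_simp
  have e1 := mul_le_mul_of_nonneg_left hest hm.le
  have e2 := mul_le_mul_of_nonneg_left hBe hm.le
  have e3 := mul_le_mul_of_nonneg_left hJe (by positivity : 0 ≤ 2 * m ^ 2)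
  have p1 : 0 ≤ m * (c * Bw) := by positivity
  have p2 : 0 ≤ m ^ 2 * (c * Jw) := by positivity
  have a1 : ε * (m ^ 2 * Jtt) * 5 ≤ c * (m ^ 2 * Jtt) := by
    have := mul_le_mul_of_nonneg_right hεc (by positivity : 0 ≤ m ^ 2 * Jtt)
    linarith
  have a2 : ε * (m ^ 2 * Jxx) * 5 ≤ c * (m ^ 2 * Jxx) := by
    have := mul_le_mul_of_nonneg_right hεc (by positivity : 0 ≤ m ^ 2 * Jxx)
    linarith
  have a3 : ε * (m ^ 2 * Jyy) * 5 ≤ c * (m ^ 2 * Jyy) := by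
    have := mul_le_mul_of_nonneg_right hεc (by positivity : 0 ≤ m ^ 2 * Jyy)
    linarith
  have q1 : 0 ≤ ε * (m ^ 2 * Jtt) := by positivity
  have q2 : 0 ≤ ε * (m ^ 2 * Jxx) := by positivity
  have q3 : 0 ≤ ε * (m ^ 2 * Jyy) := by positivity
  have hSg : c * S ≤ Jg / c := by
    rw [hS]
    linarith
  have hSg' : c ^ 2 * S ≤ Jg := by
    rw [le_div_iff₀ hc] at hSg
    linarith
  have f1 := mul_le_mul_of_nonneg_left hBx' hm.le
  have f2 := mul_le_mul_of_nonneg_left hBy' hm.le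
  have f3 := mul_le_mul_of_nonneg_left hJx' (sq_nonneg m)
  have f4 := mul_le_mul_of_nonneg_left hJy' (sq_nonneg m)
  have s1 : 0 ≤ m * Btt := by positivity
  have s2 : 0 ≤ m * Bxx := by positivity
  have s3 : 0 ≤ m * Byy := by positivity
  have s4 : 0 ≤ m ^ 2 * Jxx := by positivity
  have s5 : 0 ≤ m ^ 2 * Jyy := by positivity
  have s6 : 0 ≤ m ^ 2 * Jtt := by positivity
  have hG : (m ^ 5 * (3 * Bu) + m ^ 3 * (Bt + Bx + By) + m * (Btt + Bxx + Byy))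
      + (m ^ 6 * (3 * Ju) + m ^ 4 * (Jt + Jx + Jy) + m ^ 2 * (Jtt + Jxx + Jyy)) ≤ 7 * S := by
    rw [hS]
    linarith
  calc _ ≤ c ^ 2 / 7 * (7 * S) := by gcongr
    _ = c ^ 2 * S := by ring
    _ ≤ Jg := hSg'

variable {K : Set (ℝ × ℝ)} {u : ℝ × ℝ → ℂ}

theorem Pfib_eq (hK : IsClosed K) (hu : TestOn K u) (b ξ : ℝ) :
    Pfib b ξ u = fun p => Complex.I * cubicOperator b ξ u p := by
  have ht := hu.partialT hK
  have htt := ht.partialT hK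
  have htx := ht.partialX hK
  have h1 : D0 (D0 (D0 u)) = fun p => Complex.I * partialT (partialT (partialT u)) p := by
    simp only [D0_eq, partialT_const_mul ht.differentiable,
      partialT_const_mul (htt.neg_I_smul).differentiable, partialT_const_mul htt.differentiable]
    funext p
    linear_combination (-Complex.I * partialT (partialT (partialT u)) p) * Complex.I_mul_I
  have h2 : D1 (D1 (D0 u)) = fun p => Complex.I * partialX (partialX (partialT u)) p := by
    simp only [D0_eq, D1_eq, partialX_const_mul ht.differentiable,
      partialX_const_mul (htx.neg_I_smul).differentiable, partialX_const_mul htx.differentiable]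
    funext p
    linear_combination (-Complex.I * partialX (partialX (partialT u)) p) * Complex.I_mul_I
  funext p
  simp only [Pfib, h1, h2]
  simp only [D0_eq, cubicOperator, oscillator]
  push_cast
  linear_combination (-(b * (p.2 * ξ) ^ 3 * u p) : ℂ) * Complex.I_mul_I

theorem nsq_Pfib (hK : IsClosed K) (hu : TestOn K u) (b ξ t : ℝ) :
    nsq (Pfib b ξ u) t = ∫ x, ‖cubicOperator b ξ u (t, x)‖ ^ 2 := by
  simp [nsq, Pfib_eq hK hu]

theorem Ej_zero (ξ t : ℝ) :
    Ej ξ 0 u t = (∫ x, ‖u (t, x)‖ ^ 2) + (∫ x, ‖u (t, x)‖ ^ 2) + ∫ x, ‖u (t, x)‖ ^ 2 := by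
  simp [Ej, nsq]

theorem Ej_one (ξ t : ℝ) :
    Ej ξ 1 u t = (∫ x, ‖partialT u (t, x)‖ ^ 2) + (∫ x, ‖partialX u (t, x)‖ ^ 2)
      + ∫ x, (x * ξ) ^ 2 * ‖u (t, x)‖ ^ 2 := by
  simp [Ej, nsq, D0_eq, D1_eq, mul_pow]

theorem Ej_two (hK : IsClosed K) (hu : TestOn K u) (ξ t : ℝ) :
    Ej ξ 2 u t = (∫ x, ‖partialT (partialT u) (t, x)‖ ^ 2)
      + (∫ x, ‖partialX (partialX u) (t, x)‖ ^ 2) + ∫ x, (x * ξ) ^ 4 * ‖u (t, x)‖ ^ 2 := by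
  have h1 : D0 (D0 u) = fun p => -partialT (partialT u) p := by
    simp only [D0_eq, partialT_const_mul (hu.partialT hK).differentiable]
    funext p
    linear_combination partialT (partialT u) p * Complex.I_mul_I
  have h2 : D1 (D1 u) = fun p => -partialX (partialX u) p := by
    simp only [D1_eq, partialX_const_mul (hu.partialX hK).differentiable]
    funext p
    linear_combination partialX (partialX u) p * Complex.I_mul_I
  simp only [Ej, nsq, Function.iterate_succ, Function.iterate_zero, Function.comp, id, h1, h2,
    norm_neg, norm_mul, Complex.norm_real, mul_pow, norm_pow, Real.norm_eq_abs, sq_abs]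
  congr 2
  funext x
  ring

theorem integral_halfLine_sum_three {m a c : ℝ} (hK : IsCompact K) {φ₁ φ₂ φ₃ : ℝ × ℝ → ℝ}
    (h₁ : Continuous φ₁) (h₂ : Continuous φ₂) (h₃ : Continuous φ₃)
    (z₁ : ∀ p ∉ K, φ₁ p = 0) (z₂ : ∀ p ∉ K, φ₂ p = 0) (z₃ : ∀ p ∉ K, φ₃ p = 0) :
    ∫ t in Set.Ioi 0, Real.exp (2 * m * (t - a)) * c *
        ((∫ x, φ₁ (t, x)) + (∫ x, φ₂ (t, x)) + ∫ x, φ₃ (t, x)) =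
      c * (∫ p, φ₁ p ∂((halfLineWeight m a).prod volume)
        + ∫ p, φ₂ p ∂((halfLineWeight m a).prod volume)
        + ∫ p, φ₃ p ∂((halfLineWeight m a).prod volume)) := by
  have i₁ := integrable_of_continuous_of_zero_off (ν := (halfLineWeight m a).prod volume) hK h₁ z₁
  have i₂ := integrable_of_continuous_of_zero_off (ν := (halfLineWeight m a).prod volume) hK h₂ z₂
  have i₃ := integrable_of_continuous_of_zero_off (ν := (halfLineWeight m a).prod volume) hK h₃ z₃
  rw [← integral_add i₁ i₂, ← integral_add (f := fun p => φ₁ p + φ₂ p) (i₁.add i₂) i₃,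
    integral_halfLineWeight_prod hK (φ := fun p => φ₁ p + φ₂ p + φ₃ p) (by fun_prop)
      (fun p hp => by simp [z₁ p hp, z₂ p hp, z₃ p hp]), ← integral_const_mul]
  refine integral_congr_ae (.of_forall fun t => ?_)
  have s₁ : Integrable fun x => φ₁ (t, x) :=
    (by fun_prop : Continuous fun x => φ₁ (t, x)).integrable_of_hasCompactSupport
      (hasCompactSupport_slice_right hK z₁ t)
  have s₂ : Integrable fun x => φ₂ (t, x) :=
    (by fun_prop : Continuous fun x => φ₂ (t, x)).integrable_of_hasCompactSupport
      (hasCompactSupport_slice_right hK z₂ t)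
  have s₃ : Integrable fun x => φ₃ (t, x) :=
    (by fun_prop : Continuous fun x => φ₃ (t, x)).integrable_of_hasCompactSupport
      (hasCompactSupport_slice_right hK z₃ t)
  simp only
  rw [integral_add (f := fun x => φ₁ (t, x) + φ₂ (t, x)) (s₁.add s₂) s₃, integral_add s₁ s₂]
  ring

theorem exists_coercivity_parameters {b : ℝ} (hb : |b| < 2 / (3 * Real.sqrt 3)) :
    ∃ θ r : ℝ, 0 < θ ∧ θ < 1 ∧ 3 * r ^ 2 ≤ 1 ∧ b = 2 / 3 * θ * r ∧ |b| ≤ 1 / 2 := by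
  have h3 : Real.sqrt 3 ^ 2 = 3 := Real.sq_sqrt (by norm_num)
  have hs : 0 < Real.sqrt 3 := Real.sqrt_pos.2 (by norm_num)
  rw [lt_div_iff₀ (by positivity)] at hb
  set q := 3 * Real.sqrt 3 / 2 * |b| with hq
  have hq0 : 0 ≤ q := by positivity
  have hq1 : q < 1 := by rw [hq]; linarith
  have hq2 : q ^ 2 = 27 / 4 * b ^ 2 := by
    rw [hq, mul_pow, div_pow, mul_pow, h3, sq_abs]; ring
  have hθ : 0 < (1 + q) / 2 := by linarith
  refine ⟨(1 + q) / 2, 3 * b / (2 * ((1 + q) / 2)), hθ, by linarith, ?_, by field_simp, ?_⟩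
  · rw [div_pow, mul_div_assoc', div_le_one (by positivity)]
    nlinarith
  · have : 4 / 3 ≤ Real.sqrt 3 := Real.le_sqrt_of_sq_le (by norm_num)
    nlinarith [abs_nonneg b]

end Assembly

section Main

variable {K : Set (ℝ × ℝ)} {u : ℝ × ℝ → ℂ}

theorem Ej_nonneg (ξ : ℝ) (j : ℕ) (t : ℝ) : 0 ≤ Ej ξ j u t := by
  unfold Ej nsq
  positivity

theorem weighted_integral_Ej {m a : ℝ} (hK : IsCompact K) (hu : TestOn K u) (ξ c : ℝ) :
    (∫ t in Set.Ioi 0, Real.exp (2 * m * (t - a)) * c * Ej ξ 0 u t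
      = c * (3 * ∫ p, ‖u p‖ ^ 2 ∂((halfLineWeight m a).prod volume))) ∧
    (∫ t in Set.Ioi 0, Real.exp (2 * m * (t - a)) * c * Ej ξ 1 u t
      = c * (∫ p, ‖partialT u p‖ ^ 2 ∂((halfLineWeight m a).prod volume)
        + ∫ p, ‖partialX u p‖ ^ 2 ∂((halfLineWeight m a).prod volume)
        + ∫ p, (p.2 * ξ) ^ 2 * ‖u p‖ ^ 2 ∂((halfLineWeight m a).prod volume))) ∧
    (∫ t in Set.Ioi 0, Real.exp (2 * m * (t - a)) * c * Ej ξ 2 u t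
      = c * (∫ p, ‖partialT (partialT u) p‖ ^ 2 ∂((halfLineWeight m a).prod volume)
        + ∫ p, ‖partialX (partialX u) p‖ ^ 2 ∂((halfLineWeight m a).prod volume)
        + ∫ p, (p.2 * ξ) ^ 4 * ‖u p‖ ^ 2 ∂((halfLineWeight m a).prod volume))) := by
  have hKc := hK.isClosed
  have ht := hu.partialT hKc
  have hx := hu.partialX hKc
  have htt := ht.partialT hKc
  have hxx := hx.partialX hKc
  have cu := hu.continuous
  have ct := ht.continuous
  have cx := hx.continuous
  have ctt := htt.continuous
  have cxx := hxx.continuous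
  simp only [Ej_zero, Ej_one, Ej_two hKc hu]
  refine ⟨?_, ?_, ?_⟩
  · rw [integral_halfLine_sum_three hK (φ₁ := fun p => ‖u p‖ ^ 2) (φ₂ := fun p => ‖u p‖ ^ 2)
      (φ₃ := fun p => ‖u p‖ ^ 2) (by fun_prop) (by fun_prop) (by fun_prop)
      (fun p hp => by simp [hu.zero p hp]) (fun p hp => by simp [hu.zero p hp])
      (fun p hp => by simp [hu.zero p hp])]
    ring
  · exact integral_halfLine_sum_three hK (φ₁ := fun p => ‖partialT u p‖ ^ 2)
      (φ₂ := fun p => ‖partialX u p‖ ^ 2) (φ₃ := fun p => (p.2 * ξ) ^ 2 * ‖u p‖ ^ 2)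
      (by fun_prop) (by fun_prop) (by fun_prop)
      (fun p hp => by simp [ht.zero p hp]) (fun p hp => by simp [hx.zero p hp])
      (fun p hp => by simp [hu.zero p hp])
  · exact integral_halfLine_sum_three hK (φ₁ := fun p => ‖partialT (partialT u) p‖ ^ 2)
      (φ₂ := fun p => ‖partialX (partialX u) p‖ ^ 2) (φ₃ := fun p => (p.2 * ξ) ^ 4 * ‖u p‖ ^ 2)
      (by fun_prop) (by fun_prop) (by fun_prop)
      (fun p hp => by simp [htt.zero p hp]) (fun p hp => by simp [hxx.zero p hp])
      (fun p hp => by simp [hu.zero p hp])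

theorem boundary_Ej (hK : IsCompact K) (hu : TestOn K u) (ξ : ℝ) :
    (Ej ξ 0 u 0 = 3 * ∫ p, ‖u p‖ ^ 2 ∂((Measure.dirac 0).prod volume)) ∧
    (Ej ξ 1 u 0 = ∫ p, ‖partialT u p‖ ^ 2 ∂((Measure.dirac 0).prod volume)
        + ∫ p, ‖partialX u p‖ ^ 2 ∂((Measure.dirac 0).prod volume)
        + ∫ p, (p.2 * ξ) ^ 2 * ‖u p‖ ^ 2 ∂((Measure.dirac 0).prod volume)) ∧
    (Ej ξ 2 u 0 = ∫ p, ‖partialT (partialT u) p‖ ^ 2 ∂((Measure.dirac 0).prod volume)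
        + ∫ p, ‖partialX (partialX u) p‖ ^ 2 ∂((Measure.dirac 0).prod volume)
        + ∫ p, (p.2 * ξ) ^ 4 * ‖u p‖ ^ 2 ∂((Measure.dirac 0).prod volume)) := by
  have hKc := hK.isClosed
  have h {v : ℝ × ℝ → ℂ} (hv : TestOn K v) (n : ℕ) :
      ∫ p, (p.2 * ξ) ^ n * ‖v p‖ ^ 2 ∂((Measure.dirac 0).prod volume)
        = ∫ x, (x * ξ) ^ n * ‖v (0, x)‖ ^ 2 := by
    have cv := hv.continuous
    exact integral_dirac_prod hK (φ := fun p => (p.2 * ξ) ^ n * ‖v p‖ ^ 2) (by fun_prop)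
      fun p hp => by simp [hv.zero p hp]
  have h' {v : ℝ × ℝ → ℂ} (hv : TestOn K v) :
      ∫ p, ‖v p‖ ^ 2 ∂((Measure.dirac 0).prod volume) = ∫ x, ‖v (0, x)‖ ^ 2 := by
    simpa using h hv 0
  have ht := hu.partialT hKc
  have hx := hu.partialX hKc
  rw [Ej_zero, Ej_one, Ej_two hKc hu, h' hu, h' ht, h' hx, h hu, h' (ht.partialT hKc),
    h' (hx.partialX hKc), h hu]
  exact ⟨by ring, rfl, rfl⟩

/-- The energy estimate at a fixed frequency, with the exponential weight `exp (2 m (x₀ - a))`. -/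
theorem carleman_estimate {θ r ε m a ξ : ℝ} (hθ0 : 0 < θ) (hθ1 : θ < 1) (hr : 3 * r ^ 2 ≤ 1)
    (hb : |2 / 3 * θ * r| ≤ 1 / 2) (hε : 0 < ε) (hεc : 5 * ε ≤ (1 - θ) / 9) (hm : 0 < m)
    (hξ : |ξ| ≤ ε * m ^ 2) (hK : IsCompact K) (hu : TestOn K u) :
    ((1 - θ) / 9) ^ 2 / 7 *
        (Real.exp (2 * m * (0 - a))
            * (m ^ 5 * Ej ξ 0 u 0 + m ^ 3 * Ej ξ 1 u 0 + m * Ej ξ 2 u 0)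
          + (m ^ 6 * (3 * ∫ p, ‖u p‖ ^ 2 ∂((halfLineWeight m a).prod volume))
            + m ^ 4 * (∫ p, ‖partialT u p‖ ^ 2 ∂((halfLineWeight m a).prod volume)
              + ∫ p, ‖partialX u p‖ ^ 2 ∂((halfLineWeight m a).prod volume)
              + ∫ p, (p.2 * ξ) ^ 2 * ‖u p‖ ^ 2 ∂((halfLineWeight m a).prod volume))
            + m ^ 2 * (∫ p, ‖partialT (partialT u) p‖ ^ 2 ∂((halfLineWeight m a).prod volume)
              + ∫ p, ‖partialX (partialX u) p‖ ^ 2 ∂((halfLineWeight m a).prod volume)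
              + ∫ p, (p.2 * ξ) ^ 4 * ‖u p‖ ^ 2 ∂((halfLineWeight m a).prod volume))))
      ≤ ∫ t in Set.Ioi 0, Real.exp (2 * m * (t - a)) * nsq (Pfib (2 / 3 * θ * r) ξ u) t := by
  have hKc := hK.isClosed
  have cG := cubicOperator_continuous hKc hu (2 / 3 * θ * r) ξ
  simp only [nsq_Pfib hKc hu]
  rw [← integral_halfLineWeight_prod hK (φ := fun p => ‖cubicOperator (2 / 3 * θ * r) ξ u p‖ ^ 2)
    (by fun_prop) fun p hp => by simp [cubicOperator_zero hKc hu _ ξ p hp]]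
  obtain ⟨b0, b1, b2⟩ := boundary_Ej hK hu ξ
  rw [b0, b1, b2]
  have hc : 0 < (1 - θ) / 9 := by linarith
  set w := Real.exp (2 * m * (0 - a)) with hw
  have hw0 : 0 ≤ w := (Real.exp_pos _).le
  have hx := partialX_interpolation (ρ := Measure.dirac 0) hK hu m
  have hy := weight_interpolation (ν := (Measure.dirac (0 : ℝ)).prod volume) hK hu m ξ
  have he := energy_integral_lower_bound (ρ := Measure.dirac 0) hθ0 hθ1 hr hK hu ξ
  have hx' := mul_le_mul_of_nonneg_left hx hw0
  have hy' := mul_le_mul_of_nonneg_left hy hw0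
  have he' := mul_le_mul_of_nonneg_left he hw0
  have key := absorb_lower_order (c := (1 - θ) / 9) (ε := ε) (m := m) (X := |ξ|)
    (Ju := ∫ p, ‖u p‖ ^ 2 ∂((halfLineWeight m a).prod volume))
    (Jx := ∫ p, ‖partialX u p‖ ^ 2 ∂((halfLineWeight m a).prod volume))
    (Jy := ∫ p, (p.2 * ξ) ^ 2 * ‖u p‖ ^ 2 ∂((halfLineWeight m a).prod volume))
    (Bu := w * ∫ p, ‖u p‖ ^ 2 ∂((Measure.dirac 0).prod volume))
    (Bt := w * ∫ p, ‖partialT u p‖ ^ 2 ∂((Measure.dirac 0).prod volume))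
    (Bx := w * ∫ p, ‖partialX u p‖ ^ 2 ∂((Measure.dirac 0).prod volume))
    (By := w * ∫ p, (p.2 * ξ) ^ 2 * ‖u p‖ ^ 2 ∂((Measure.dirac 0).prod volume))
    (Btt := w * ∫ p, ‖partialT (partialT u) p‖ ^ 2 ∂((Measure.dirac 0).prod volume))
    (Bxx := w * ∫ p, ‖partialX (partialX u) p‖ ^ 2 ∂((Measure.dirac 0).prod volume))
    (Byy := w * ∫ p, (p.2 * ξ) ^ 4 * ‖u p‖ ^ 2 ∂((Measure.dirac 0).prod volume))
    (Bw := w * ∫ p, ‖multiplier ξ u p‖ ^ 2 ∂((Measure.dirac 0).prod volume))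
    (Be := w * ∫ p, energy (2 / 3 * θ * r) ξ u p ∂((Measure.dirac 0).prod volume))
    hc (by linarith) hε hεc hm (abs_nonneg ξ) hξ
    (by positivity) (by positivity) (by positivity) (by positivity) (by positivity)
    (by positivity) (by positivity) (by positivity) (by positivity) (by positivity)
    (by positivity) (by positivity)
    (by rw [sq_abs]; exact energy_integral_lower_bound hθ0 hθ1 hr hK hu ξ)
    (by rw [sq_abs]; linarith)
    (energy_estimate hb hm hc a ξ hK hu)
    (partialX_interpolation hK hu m) (by linarith) (weight_interpolation hK hu m ξ)
    (by linarith) (exponential_weight_inequality hK hu m a)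
    (exponential_weight_inequality hK (hu.partialT hKc) m a)
  refine le_of_eq_of_le ?_ key
  ring

end Main

/-- The key weighted energy estimate (2.27) for the fiberwise operator `P_{ξₙ}`. -/
theorem main_energy_estimate (b₀ a : ℝ)
    (hb₀ : |b₀| < 2 / (3 * Real.sqrt 3)) (ha : 0 < a) :
    ∃ C > (0:ℝ), ∀ s : ℝ, 1 ≤ s → s ≤ 2 → ∃ τ₀ > (0:ℝ), ∀ τ : ℝ, τ₀ ≤ τ → ∀ ξₙ : ℝ,
      ∀ u : ℝ × ℝ → ℂ, ContDiff ℝ (⊤ : ℕ∞) u → HasCompactSupport u →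
        (∫ x₀ in Set.Ioi (0:ℝ), Wt τ ξₙ s a x₀ * nsq (Pfib b₀ ξₙ u) x₀)
          ≥ C * Wt τ ξₙ s a 0 *
              (∑ j ∈ Finset.range 3,
                τ ^ ((4:ℝ) - 3 * (j:ℝ) / 2)
                  * (Real.sqrt (1 + ξₙ ^ 2)) ^ (((5:ℝ) - 2 * (j:ℝ)) / s) * Ej ξₙ j u 0)
            + C * ∑ j ∈ Finset.range 3,
                τ ^ ((6:ℝ) - 2 * (j:ℝ)) *
                  ∫ x₀ in Set.Ioi (0:ℝ),
                    Wt τ ξₙ s a x₀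
                      * (Real.sqrt (1 + ξₙ ^ 2)) ^ (((6:ℝ) - 2 * (j:ℝ)) / s)
                      * Ej ξₙ j u x₀ := by
  obtain ⟨θ, r, hθ0, hθ1, hr, rfl, hb⟩ := exists_coercivity_parameters hb₀
  have hc : 0 < (1 - θ) / 9 := by linarith
  refine ⟨((1 - θ) / 9) ^ 2 / 7, by positivity, fun s hs1 hs2 =>
    ⟨1 + 5 / ((1 - θ) / 9), by positivity, fun τ hτ ξ u hu hcs => ?_⟩⟩
  have hτ1 : 1 ≤ τ := by
    have : 0 < 5 / ((1 - θ) / 9) := by positivity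
    linarith
  have hτ0 : 0 < τ := by linarith
  have hs0 : 0 < s := by linarith
  have hε : 5 * (1 / τ ^ 2) ≤ (1 - θ) / 9 := by
    have h1 : 5 / ((1 - θ) / 9) ≤ τ ^ 2 := by nlinarith
    rw [div_le_iff₀ hc] at h1
    rw [mul_one_div, div_le_iff₀ (by positivity)]
    linarith
  have hJ1 : 1 ≤ √(1 + ξ ^ 2) := Real.one_le_sqrt.2 (by nlinarith)
  have hJ0 : 0 < √(1 + ξ ^ 2) := by linarith
  set w := √(1 + ξ ^ 2) ^ (1 / s) with hw
  have hw1 : 1 ≤ w := Real.one_le_rpow hJ1 (by positivity)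
  have hw0 : 0 < w := by linarith
  have hwpow (n : ℕ) (k : ℝ) (hk : k = n) : √(1 + ξ ^ 2) ^ (k / s) = w ^ n := by
    rw [hk, hw, ← Real.rpow_mul_natCast hJ0.le]
    congr 1
    ring
  have hξ : |ξ| ≤ 1 / τ ^ 2 * (τ * w) ^ 2 := by
    calc |ξ| ≤ √(1 + ξ ^ 2) := Real.abs_le_sqrt (by linarith)
      _ = w ^ s := by rw [hw, ← Real.rpow_mul hJ0.le, one_div_mul_cancel hs0.ne', Real.rpow_one]
      _ ≤ w ^ (2 : ℝ) := Real.rpow_le_rpow_of_exponent_le hw1 hs2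
      _ = 1 / τ ^ 2 * (τ * w) ^ 2 := by rw [Real.rpow_two]; field_simp
  have hWt (t : ℝ) : Wt τ ξ s a t = Real.exp (2 * (τ * w) * (t - a)) := by
    rw [Wt, mul_assoc 2 τ]
  have hcs' : IsCompact (tsupport u) := hcs
  have hT : TestOn (tsupport u) u := ⟨hu, fun p hp => image_eq_zero_of_notMem_tsupport hp⟩
  have key := carleman_estimate (a := a) hθ0 hθ1 hr hb (by positivity) hε (mul_pos hτ0 hw0) hξ
    hcs' hT
  have i0 := (weighted_integral_Ej (m := τ * w) (a := a) hcs' hT ξ (w ^ 6)).1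
  have i1 := (weighted_integral_Ej (m := τ * w) (a := a) hcs' hT ξ (w ^ 4)).2.1
  have i2 := (weighted_integral_Ej (m := τ * w) (a := a) hcs' hT ξ (w ^ 2)).2.2
  simp only [hWt, Finset.sum_range_succ, Finset.sum_range_zero, zero_add, Nat.cast_zero,
    Nat.cast_one, Nat.cast_ofNat]
  rw [hwpow 5 _ (by norm_num), hwpow 3 _ (by norm_num), hwpow 1 _ (by norm_num),
    hwpow 6 _ (by norm_num), hwpow 4 _ (by norm_num), hwpow 2 _ (by norm_num), i0, i1, i2]
  have hτpow (n : ℕ) (k : ℝ) (hk : k ≤ n) : τ ^ k ≤ τ ^ n := by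
    rw [← Real.rpow_natCast]
    exact Real.rpow_le_rpow_of_exponent_le hτ1 hk
  have hτpow' (n : ℕ) (k : ℝ) (hk : k = n) : τ ^ k = τ ^ n := by
    rw [hk, Real.rpow_natCast]
  rw [hτpow' 6 (6 - 2 * 0) (by norm_num), hτpow' 4 (6 - 2 * 1) (by norm_num),
    hτpow' 2 (6 - 2 * 2) (by norm_num)]
  have e0 := mul_le_mul_of_nonneg_right (hτpow 5 (4 - 3 * 0 / 2) (by norm_num))
    (mul_nonneg (pow_nonneg hw0.le 5) (Ej_nonneg (u := u) ξ 0 0))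
  have e1 := mul_le_mul_of_nonneg_right (hτpow 3 (4 - 3 * 1 / 2) (by norm_num))
    (mul_nonneg (pow_nonneg hw0.le 3) (Ej_nonneg (u := u) ξ 1 0))
  have e2 := mul_le_mul_of_nonneg_right (hτpow 1 (4 - 3 * 2 / 2) (by norm_num))
    (mul_nonneg (pow_nonneg hw0.le 1) (Ej_nonneg (u := u) ξ 2 0))
  have e := mul_le_mul_of_nonneg_left (add_le_add (add_le_add e0 e1) e2)
    (mul_nonneg (by positivity : 0 ≤ ((1 - θ) / 9) ^ 2 / 7)
      (Real.exp_pos (2 * (τ * w) * (0 - a))).le)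
  refine le_trans ?_ key
  linarith
end

section
/- Let ω = exp(2πi/5) and let C : ℂ → ℂ be an entire function satisfying: (i) C(ζ) + ω² C(ωζ) C(ω⁴ζ) − ω³ = 0 for all ζ ∈ ℂ; (ii) C(0) = 1 + ω; (iii) C′(0) ≠ 0. Then there exists ζ₀ ∈ ℂ with ζ₀ ≠ 0 and C(ζ₀) = 0. -/
open Complex

/-- `ω = exp(2πi/5)`. -/
noncomputable def ω5 : ℂ := Complex.exp (2 * (Real.pi : ℂ) * Complex.I / 5)

open Metric Set Filter Topology

/-- A holomorphic function whose derivative at most doubles on a disk covers a disk of comparable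
size around the image of the centre. -/
theorem ball_subset_range_of_norm_deriv_le {f : ℂ → ℂ} (hf : Differentiable ℂ f) {p : ℂ} {t : ℝ}
    (ht : 0 < t) (hp : deriv f p ≠ 0) (hb : ∀ z ∈ ball p t, ‖deriv f z‖ ≤ 2 * ‖deriv f p‖) :
    ball (f p) (t * ‖deriv f p‖ / 24) ⊆ range f := by
  have hd : Differentiable ℂ (deriv f) := fun z =>
    (hf.differentiableOn.deriv isOpen_univ).differentiableAt univ_mem
  have hp' : 0 < ‖deriv f p‖ := norm_pos_iff.mpr hp
  have hmaps : MapsTo (deriv f) (ball p t) (closedBall (deriv f p) (3 * ‖deriv f p‖)) := by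
    intro z hz
    rw [mem_closedBall, dist_eq_norm]
    linarith [norm_sub_le (deriv f z) (deriv f p), hb z hz]
  have hclose : ∀ z ∈ closedBall p (t / 6),
      ‖deriv f z - deriv f p‖ ≤ ‖deriv f p‖ / 2 := by
    intro z hz
    have hz' : dist z p ≤ t / 6 := hz
    have h := dist_le_div_mul_dist_of_mapsTo_ball hd.differentiableOn hmaps
      (mem_ball.mpr (by linarith : dist z p < t))
    rw [dist_eq_norm (deriv f z)] at h
    calc _ ≤ _ := h
      _ ≤ 3 * ‖deriv f p‖ / t * (t / 6) := by gcongr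
      _ = _ := by field_simp; norm_num
  have hlower : ∀ z ∈ sphere p (t / 6), t * ‖deriv f p‖ / 12 ≤ ‖f z - f p‖ := by
    intro z hz
    have hder : ∀ x, HasDerivAt (fun x => f x - deriv f p * x) (deriv f x - deriv f p) x :=
      fun x => by simpa using (hf x).hasDerivAt.fun_sub ((hasDerivAt_id x).const_mul (deriv f p))
    have h := (convex_closedBall p (t / 6)).norm_image_sub_le_of_norm_hasDerivWithin_le
      (fun x _ => (hder x).hasDerivWithinAt) hclose (mem_closedBall_self (by positivity))
      (sphere_subset_closedBall hz)
    have hz' : ‖z - p‖ = t / 6 := by rw [← dist_eq_norm]; exact hz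
    have htri := norm_sub_norm_le (deriv f p * (z - p)) (-(f z - f p - deriv f p * (z - p)))
    rw [norm_neg, norm_mul, hz',
      show deriv f p * (z - p) - -(f z - f p - deriv f p * (z - p)) = f z - f p by ring] at htri
    rw [hz', show f z - deriv f p * z - (f p - deriv f p * p)
      = f z - f p - deriv f p * (z - p) by ring] at h
    linarith
  have hne : ∃ᶠ z in 𝓝 p, f z ≠ f p :=
    ((hf p).hasDerivAt.eventually_ne hp).frequently.filter_mono nhdsWithin_le_nhds
  have h := hf.diffContOnCl.ball_subset_image_closedBall (by positivity) hlower hne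
  rw [show t * ‖deriv f p‖ / 24 = t * ‖deriv f p‖ / 12 / 2 by ring]
  exact h.trans (image_subset_range _ _)

/-- A weak form of **Bloch's theorem**: the range of an entire function with a nonzero derivative
contains disks of every radius. -/
theorem exists_ball_subset_range {f : ℂ → ℂ} (hf : Differentiable ℂ f) {z₀ : ℂ}
    (h₀ : deriv f z₀ ≠ 0) (r : ℝ) : ∃ w, ball w r ⊆ range f := by
  have hd : Differentiable ℂ (deriv f) := fun z =>
    (hf.differentiableOn.deriv isOpen_univ).differentiableAt univ_mem
  have h₀' : 0 < ‖deriv f z₀‖ := norm_pos_iff.mpr h₀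
  obtain ⟨R, hR, hRr⟩ : ∃ R > 0, r ≤ R * ‖deriv f z₀‖ / 48 := by
    refine ⟨48 * (|r| + 1) / ‖deriv f z₀‖, by positivity, ?_⟩
    rw [div_mul_cancel₀ _ h₀'.ne']
    linarith [le_abs_self r]
  have hcont : Continuous fun z => (R - dist z z₀) * ‖deriv f z‖ :=
    (continuous_const.sub (continuous_id.dist continuous_const)).mul hd.continuous.norm
  obtain ⟨p, hpR, hmax⟩ := (isCompact_closedBall z₀ R).exists_isMaxOn
    ⟨z₀, mem_closedBall_self hR.le⟩ hcont.continuousOn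
  have hz₀ : R * ‖deriv f z₀‖ ≤ (R - dist p z₀) * ‖deriv f p‖ := by
    simpa using hmax (mem_closedBall_self hR.le)
  have hpos : 0 < (R - dist p z₀) * ‖deriv f p‖ := lt_of_lt_of_le (by positivity) hz₀
  have hp : 0 < ‖deriv f p‖ := by
    refine (norm_nonneg _).lt_of_ne fun h => ?_
    simp [← h] at hpos
  have ht : 0 < R - dist p z₀ := pos_of_mul_pos_left hpos hp.le
  refine ⟨f p, (ball_subset_ball ?_).trans (ball_subset_range_of_norm_deriv_le hf (half_pos ht)
    (norm_pos_iff.mp hp) fun z hz => ?_)⟩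
  · linarith
  · have hz' : dist z p < (R - dist p z₀) / 2 := hz
    have htri := dist_triangle z p z₀
    have hzR : z ∈ closedBall z₀ R := mem_closedBall.mpr (by linarith)
    have h : (R - dist z z₀) * ‖deriv f z‖ ≤ (R - dist p z₀) * ‖deriv f p‖ := hmax hzR
    have h' : (R - dist p z₀) / 2 * ‖deriv f z‖ ≤ (R - dist z z₀) * ‖deriv f z‖ := by
      gcongr
      linarith
    nlinarith

/-- A nowhere vanishing entire function has an entire logarithm. -/
theorem exists_differentiable_exp_eq {f : ℂ → ℂ} (hf : Differentiable ℂ f) (h₀ : ∀ z, f z ≠ 0) :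
    ∃ g : ℂ → ℂ, Differentiable ℂ g ∧ ∀ z, exp (g z) = f z := by
  have hd : Differentiable ℂ (deriv f) := fun z =>
    (hf.differentiableOn.deriv isOpen_univ).differentiableAt univ_mem
  obtain ⟨g, hg₀, hg⟩ := (hd.div hf h₀).isExactOn_univ.with_val_at 0 (log (f 0))
  have hg' := fun z => hg z (mem_univ z)
  refine ⟨g, fun z => (hg' z).differentiableAt, fun z => ?_⟩
  have hder : ∀ x, HasDerivAt (fun x => f x * exp (-g x)) 0 x := fun x => by
    have h := (hf x).hasDerivAt.fun_mul (hg' x).fun_neg.cexp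
    have hfx := h₀ x
    rwa [Pi.div_apply, show deriv f x * exp (-g x) + f x * (exp (-g x) * -(deriv f x / f x)) = 0 by
      field_simp
      ring] at h
  have hconst := is_const_of_deriv_eq_zero (fun x => (hder x).differentiableAt)
    (fun x => (hder x).deriv) z 0
  simp only [hg₀, exp_neg, exp_log (h₀ 0), mul_inv_cancel₀ (h₀ 0)] at hconst
  field_simp at hconst
  exact hconst.symm

theorem Real.exists_cosh_sq_eq_natCast (x : ℝ) :
    ∃ y : ℝ, |y - x| ≤ 1 ∧ ∃ n : ℕ, Real.cosh y ^ 2 = n := by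
  wlog hx : 0 ≤ x generalizing x
  · obtain ⟨y, hy, n, hn⟩ := this (-x) (by linarith)
    refine ⟨-y, ?_, n, by simpa using hn⟩
    rwa [← abs_neg, neg_sub, sub_neg_eq_add, add_comm, ← sub_neg_eq_add]
  have hgrow : Real.cosh x ^ 2 + 1 ≤ Real.cosh (x + 1) ^ 2 := by
    have h1 : 1 ≤ Real.sinh 1 := Real.self_le_sinh_iff.mpr zero_le_one
    have h2 : 0 ≤ Real.sinh x := Real.sinh_nonneg_iff.mpr hx
    have h3 : 1 ≤ Real.cosh x ^ 2 * Real.sinh 1 ^ 2 :=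
      one_le_mul_of_one_le_of_one_le (one_le_pow₀ (Real.one_le_cosh x)) (one_le_pow₀ h1)
    have h4 : 0 ≤ (Real.cosh x * Real.cosh 1) * (Real.sinh x * Real.sinh 1) := by positivity
    have h5 : (Real.cosh x * Real.cosh 1) ^ 2
        = Real.cosh x ^ 2 + Real.cosh x ^ 2 * Real.sinh 1 ^ 2 := by
      rw [mul_pow, Real.cosh_sq 1]; ring
    rw [Real.cosh_add, add_sq]
    nlinarith [sq_nonneg (Real.sinh x * Real.sinh 1)]
  obtain ⟨y, ⟨hxy, hyx⟩, hy⟩ := intermediate_value_Icc (by linarith : x ≤ x + 1)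
    (Real.continuous_cosh.pow 2).continuousOn
    ⟨Nat.le_ceil (Real.cosh x ^ 2), (Nat.ceil_lt_add_one (sq_nonneg _)).le.trans hgrow⟩
  exact ⟨y, abs_le.mpr ⟨by linarith, by linarith⟩, _, hy⟩

theorem Complex.exists_cosh_sq_eq_natCast (w : ℂ) :
    ∃ v ∈ ball w 3, ∃ n : ℕ, cosh v ^ 2 = n := by
  obtain ⟨y, hy, n, hn⟩ := Real.exists_cosh_sq_eq_natCast w.re
  set k : ℤ := round (w.im / Real.pi)
  have hk : |(k : ℝ) * Real.pi - w.im| ≤ Real.pi / 2 := by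
    have h := abs_sub_round (w.im / Real.pi)
    calc |(k : ℝ) * Real.pi - w.im| = |w.im / Real.pi - k| * Real.pi := by
          rw [← abs_of_pos Real.pi_pos, ← abs_mul, abs_of_pos Real.pi_pos, abs_sub_comm]
          congr 1
          field_simp
      _ ≤ 1 / 2 * Real.pi := by gcongr
      _ = _ := by ring
  refine ⟨y + (k * Real.pi : ℝ) * I, ?_, n, ?_⟩
  · rw [mem_ball, dist_eq_norm]
    calc _ ≤ |((y + (k * Real.pi : ℝ) * I : ℂ) - w).re|
          + |((y + (k * Real.pi : ℝ) * I : ℂ) - w).im| := norm_le_abs_re_add_abs_im _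
      _ = |y - w.re| + |k * Real.pi - w.im| := by simp
      _ < 3 := by linarith [Real.pi_lt_four]
  · have hsin : Real.sin (k * Real.pi) = 0 := Real.sin_int_mul_pi k
    have hcos : Real.cos (k * Real.pi) ^ 2 = 1 := by
      have := Real.sin_sq_add_cos_sq (k * Real.pi)
      simpa [hsin] using this
    rw [cosh_add, cosh_mul_I, sinh_mul_I, ← ofReal_sin, hsin, ← ofReal_cos, ofReal_zero, zero_mul,
      mul_zero, add_zero, mul_pow, ← ofReal_pow, hcos, ← ofReal_cosh, ← ofReal_pow, hn]
    simp

/-- An entire function omitting `0` and `1` is of the form `exp (2πi cosh² g)` with `g` entire. -/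
theorem exists_differentiable_exp_cosh_sq_eq {f : ℂ → ℂ} (hf : Differentiable ℂ f)
    (h₀ : ∀ z, f z ≠ 0) (h₁ : ∀ z, f z ≠ 1) :
    ∃ g : ℂ → ℂ, Differentiable ℂ g ∧
      ∀ z, exp (cosh (g z) ^ 2 * (2 * Real.pi * I)) = f z := by
  obtain ⟨l, hl, hlf⟩ := exists_differentiable_exp_eq hf h₀
  have hne : ∀ (n : ℤ) z, l z / (2 * Real.pi * I) ≠ n := fun n z h => by
    refine h₁ z ?_
    rw [← hlf, (div_eq_iff two_pi_I_ne_zero).mp h, exp_int_mul_two_pi_mul_I]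
  obtain ⟨a, ha, haf⟩ := exists_differentiable_exp_eq (hl.div_const (2 * Real.pi * I))
    (fun z => by simpa using hne 0 z)
  obtain ⟨b, hb, hbf⟩ := exists_differentiable_exp_eq ((hl.div_const (2 * Real.pi * I)).sub_const 1)
    (fun z => by simpa [sub_eq_zero] using hne 1 z)
  have hsq : ∀ (u : ℂ), exp (u / 2) ^ 2 = exp u := fun u => by
    rw [← exp_nat_mul]; congr 1; push_cast; ring
  have hprod : ∀ z, (exp (a z / 2) - exp (b z / 2)) * (exp (a z / 2) + exp (b z / 2)) = 1 :=
    fun z => by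
      linear_combination hsq (a z) - hsq (b z) + haf z - hbf z
  obtain ⟨g, hg, hgf⟩ := exists_differentiable_exp_eq
    ((ha.div_const 2).cexp.sub (hb.div_const 2).cexp)
    (fun z => left_ne_zero_of_mul_eq_one (hprod z))
  refine ⟨g, hg, fun z => ?_⟩
  have hneg : exp (-g z) = exp (a z / 2) + exp (b z / 2) := by
    rw [exp_neg, hgf]
    exact inv_eq_of_mul_eq_one_right (hprod z)
  have hcosh : cosh (g z) = exp (a z / 2) := by
    rw [cosh, hneg, hgf]
    simp only [Pi.sub_apply]
    ring
  rw [hcosh, hsq, haf, div_mul_cancel₀ _ two_pi_I_ne_zero, hlf]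

/-- The derivative form of **Picard's little theorem**. -/
theorem deriv_eq_zero_of_omits_two_values {f : ℂ → ℂ} (hf : Differentiable ℂ f) {a b : ℂ}
    (hab : a ≠ b) (ha : ∀ z, f z ≠ a) (hb : ∀ z, f z ≠ b) (z : ℂ) : deriv f z = 0 := by
  have hba : b - a ≠ 0 := sub_ne_zero.mpr hab.symm
  obtain ⟨g, hg, hgf⟩ := exists_differentiable_exp_cosh_sq_eq
    ((hf.sub_const a).div_const (b - a))
    (fun z => div_ne_zero (sub_ne_zero.mpr (ha z)) hba)
    (fun z h => hb z (by linear_combination (div_eq_one_iff_eq hba).mp h))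
  have hg' : deriv g z = 0 := by
    by_contra hgz
    obtain ⟨w, hw⟩ := exists_ball_subset_range hg hgz 3
    obtain ⟨v, hv, n, hn⟩ := Complex.exists_cosh_sq_eq_natCast w
    obtain ⟨x, rfl⟩ := hw hv
    have h := hgf x
    rw [hn, exp_nat_mul_two_pi_mul_I, eq_comm, div_eq_one_iff_eq hba] at h
    exact hb x (by linear_combination h)
  have hfg : f = fun z => exp (cosh (g z) ^ 2 * (2 * Real.pi * I)) * (b - a) + a := by
    ext z
    rw [hgf, div_mul_cancel₀ _ hba, sub_add_cancel]
  have hder := ((((hg z).hasDerivAt.ccosh.pow 2).mul_const (2 * Real.pi * I)).cexp.mul_const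
    (b - a)).add_const a
  rw [hg'] at hder
  rw [hfg]
  simpa using hder.deriv

theorem ω5_pow_five : ω5 ^ 5 = 1 := by
  rw [ω5, ← exp_nat_mul, ← exp_two_pi_mul_I]
  congr 1
  push_cast
  ring

/-- Lemma 3.4: an entire function `C` satisfying the Stokes functional equation, with
`C(0) = 1 + ω` and `C′(0) ≠ 0`, has a nonzero zero `ζ₀`. -/
theorem stokes_coefficient_vanishes (C : ℂ → ℂ) (hC : Differentiable ℂ C)
    (hfe : ∀ ζ : ℂ, C ζ + ω5 ^ 2 * C (ω5 * ζ) * C (ω5 ^ 4 * ζ) - ω5 ^ 3 = 0)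
    (h₀ : C 0 = 1 + ω5) (h₁ : deriv C 0 ≠ 0) :
    ∃ ζ₀ : ℂ, ζ₀ ≠ 0 ∧ C ζ₀ = 0 := by
  have hω : ω5 ≠ 0 := exp_ne_zero _
  suffices h : ∃ ζ, C ζ = 0 by
    obtain ⟨ζ, hζ⟩ := h
    refine ⟨ζ, ?_, hζ⟩
    rintro rfl
    have hω' : ω5 = -1 := by linear_combination hζ - h₀
    have h5 := ω5_pow_five
    norm_num [hω'] at h5
  by_contra! hne
  refine h₁ (deriv_eq_zero_of_omits_two_values hC (pow_ne_zero 3 hω).symm hne (fun ζ hζ => ?_) 0)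
  have h := hfe ζ
  rw [hζ, add_sub_cancel_left] at h
  exact mul_ne_zero (mul_ne_zero (pow_ne_zero 2 hω) (hne _)) (hne _) h
end
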